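/- arXiv:math/0603570 — 2 statements merged into one kernel-verified Lean document; each statement's English description precedes it below -/
import Mathlib

section
/- Let N ≥ 1, T > 0, let c0, c1 : ℝ^N × [0,T] → ℝ be continuous and both satisfy (H1) and (H5), and let ρ : ℝ^N × [0,T] → ℝ be measurable with 0 ≤ ρ(x,t) ≤ 1 for almost every (x,t) and with t ↦ ρ(·,t) continuous from [0,T] into L¹(ℝ^N). Let u0 : ℝ^N → ℝ be Lipschitz continuous satisfying (H3), with {x : u0(x) ≥ 0} compact, and let u be the continuous viscosity solution of u_t = c[ρ](x,t)|Du| with initial datum u0. Then the map t ↦ 1_{{x : u(x,t) ≥ 0}} from [0,T] into L¹(ℝ^N) is continuous. -/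
open Set MeasureTheory Filter Metric
open scoped Topology ENNReal NNReal RealInnerProductSpace symmDiff

noncomputable section

/-- Euclidean space ℝ^N. -/
abbrev Euc (N : ℕ) := EuclideanSpace ℝ (Fin N)

/-- The Fréchet superdifferential D⁺v(x): the set of p with
limsup_{y→x} (v(y) − v(x) − ⟨p, y−x⟩)/|y−x| ≤ 0. -/
def SuperDiff {N : ℕ} (v : Euc N → ℝ) (x : Euc N) : Set (Euc N) :=
  {p | ∀ ε > 0, ∀ᶠ y in 𝓝[≠] x, (v y - v x - ⟪p, y - x⟫) / ‖y - x‖ ≤ ε}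

/-- Semiconvexity with constant C: v(x+h) − 2v(x) + v(x−h) ≥ −C|h|². -/
def Semiconvex {N : ℕ} (C : ℝ) (v : Euc N → ℝ) : Prop :=
  ∀ x h : Euc N, v (x + h) - 2 * v x + v (x - h) ≥ -C * ‖h‖ ^ 2

/-- Viscosity solution of u_t = c(x,t)|Du| on ℝ^N × (0,T) with initial datum u0. -/
def IsViscositySolution (N : ℕ) (T : ℝ) (c u : Euc N → ℝ → ℝ) (u0 : Euc N → ℝ) : Prop :=
  (∀ x, u x 0 = u0 x) ∧
  ∀ φ : Euc N → ℝ → ℝ,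
    ContDiff ℝ 1 (fun p : Euc N × ℝ => φ p.1 p.2) →
    ∀ x0 : Euc N, ∀ t0 ∈ Set.Ioo 0 T,
      (IsLocalMaxOn (fun p : Euc N × ℝ => u p.1 p.2 - φ p.1 p.2)
          (Set.univ ×ˢ Set.Icc 0 T) (x0, t0) →
        deriv (φ x0) t0 ≤ c x0 t0 * ‖gradient (fun x => φ x t0) x0‖) ∧
      (IsLocalMinOn (fun p : Euc N × ℝ => u p.1 p.2 - φ p.1 p.2)
          (Set.univ ×ˢ Set.Icc 0 T) (x0, t0) →
        deriv (φ x0) t0 ≥ c x0 t0 * ‖gradient (fun x => φ x t0) x0‖)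

/-- The nonlocal velocity c[ρ](x,t) = (c0 ⋆ ρ(·,t))(x) + c1(x,t). -/
def convVel {N : ℕ} (c0 c1 ρ : Euc N → ℝ → ℝ) (x : Euc N) (t : ℝ) : ℝ :=
  (∫ y : Euc N, c0 (y - x) t * ρ y t) + c1 x t


/-- Subsolutions of `v_t = c(x,t)|Dv|` on `ℝ^N × (0,T)`, tested from above. -/
def IsSubsolution {N : ℕ} (T : ℝ) (c v : Euc N → ℝ → ℝ) : Prop :=
  ∀ φ : Euc N → ℝ → ℝ,
    ContDiff ℝ 1 (fun p : Euc N × ℝ => φ p.1 p.2) →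
    ∀ x0 : Euc N, ∀ t0 ∈ Set.Ioo 0 T,
      IsLocalMaxOn (fun p : Euc N × ℝ => v p.1 p.2 - φ p.1 p.2)
          (Set.univ ×ˢ Set.Icc 0 T) (x0, t0) →
        deriv (φ x0) t0 ≤ c x0 t0 * ‖gradient (fun x => φ x t0) x0‖

lemma IsViscositySolution.isSubsolution {N : ℕ} {T : ℝ} {c u : Euc N → ℝ → ℝ}
    {u0 : Euc N → ℝ} (h : IsViscositySolution N T c u u0) : IsSubsolution T c u :=
  fun φ hφ x0 t0 ht0 hmax => (h.2 φ hφ x0 t0 ht0).1 hmax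

lemma IsViscositySolution.isSubsolution_neg {N : ℕ} {T : ℝ} {c u : Euc N → ℝ → ℝ}
    {u0 : Euc N → ℝ} (h : IsViscositySolution N T c u u0) :
    IsSubsolution T (fun x t => -c x t) (fun x t => -u x t) := by
  intro φ hφ x0 t0 ht0 hmax
  have key := (h.2 (fun x t => -φ x t) hφ.neg x0 t0 ht0).2 (by
    have := hmax.neg
    refine this.congr ?_ ?_
    · exact Eventually.of_forall fun p => by simp only; ring
    · exact ⟨mem_univ _, Ioo_subset_Icc_self ht0⟩)
  have e1 : deriv (fun t => -φ x0 t) t0 = -deriv (φ x0) t0 := deriv.fun_neg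
  have e2 : ‖gradient (fun x => -φ x t0) x0‖ = ‖gradient (fun x => φ x t0) x0‖ := by
    simp [gradient, fderiv_fun_neg]
  simp only [e2] at key
  rw [e1] at key
  linarith

lemma norm_gradient_radial {N : ℕ} {F : ℝ → ℝ} {F' : ℝ} {x z : Euc N}
    (h : HasDerivAt F F' (‖z - x‖ ^ 2)) :
    ‖gradient (fun y => F (‖y - x‖ ^ 2)) z‖ = |F'| * (2 * ‖z - x‖) := by
  have h1 : HasFDerivAt (fun y : Euc N => ‖y - x‖ ^ 2) _ z :=
    ((hasFDerivAt_id z).sub_const x).norm_sq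
  have h2 := HasDerivAt.comp_hasFDerivAt (h₂ := F) z h h1
  have h3 : fderiv ℝ (fun y => F (‖y - x‖ ^ 2)) z = _ := h2.fderiv
  rw [gradient, LinearIsometryEquiv.norm_map, h3, norm_smul, Real.norm_eq_abs]
  congr 1
  have : (2 • (innerSL ℝ (z - x)).comp (ContinuousLinearMap.id ℝ (Euc N)) : Euc N →L[ℝ] ℝ)
      = (2 : ℝ) • innerSL ℝ (z - x) := by
    ext y; simp [two_smul]
  simp only [id] at *
  rw [this, norm_smul, innerSL_apply_norm]
  simp

/-- Comparison of a subsolution with a smooth supersolution on a cylinder. -/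
lemma IsSubsolution.le_of_boundary {N : ℕ} {T : ℝ} {c v : Euc N → ℝ → ℝ}
    (hsub : IsSubsolution T c v)
    (hv : ContinuousOn (fun p : Euc N × ℝ => v p.1 p.2)
      ((Set.univ : Set (Euc N)) ×ˢ Set.Icc (0 : ℝ) T))
    {s t r : ℝ} (hs : 0 ≤ s) (hst : s < t) (htT : t ≤ T) {x : Euc N}
    {φ : Euc N → ℝ → ℝ} (hφ : ContDiff ℝ 1 (fun p : Euc N × ℝ => φ p.1 p.2))
    (hsup : ∀ z ∈ ball x r, ∀ τ ∈ Ioo s t,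
      c z τ * ‖gradient (fun y => φ y τ) z‖ ≤ deriv (φ z) τ)
    (hinit : ∀ z ∈ closedBall x r, v z s ≤ φ z s)
    (hlat : ∀ z ∈ sphere x r, ∀ τ ∈ Icc s t, v z τ ≤ φ z τ) :
    ∀ z ∈ closedBall x r, ∀ τ ∈ Icc s t, v z τ ≤ φ z τ := by
  have hcont : ContinuousOn (fun p : Euc N × ℝ => v p.1 p.2 - φ p.1 p.2)
      (closedBall x r ×ˢ Icc s t) :=
    (hv.mono (prod_mono (subset_univ _) (Icc_subset_Icc hs htT))).sub hφ.continuous.continuousOn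
  have hK : IsCompact (closedBall x r ×ˢ Icc s t) :=
    (isCompact_closedBall x r).prod isCompact_Icc
  have hlt : ∀ z ∈ closedBall x r, ∀ τ ∈ Ico s t, v z τ ≤ φ z τ := by
    intro z hz τ hτ
    by_contra! hcon
    have hzτ : (z, τ) ∈ closedBall x r ×ˢ Icc s t := ⟨hz, hτ.1, hτ.2.le⟩
    obtain ⟨M, hM⟩ := (hK.bddAbove_image hcont)
    have hM' : ∀ y ∈ closedBall x r, ∀ σ ∈ Icc s t, v y σ - φ y σ ≤ M := fun y hy σ hσ =>
      hM (mem_image_of_mem (fun p : Euc N × ℝ => v p.1 p.2 - φ p.1 p.2) (mk_mem_prod hy hσ))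
    set ε := (v z τ - φ z τ) / 2 with hε
    have hε0 : 0 < ε := by rw [hε]; linarith
    obtain ⟨k, hk0, hk⟩ : ∃ k : ℝ, 0 < k ∧ M ≤ ε * Real.exp (k * (t - τ)) := by
      have h1 : Tendsto (fun k : ℝ => ε * Real.exp (k * (t - τ))) atTop atTop :=
        (Real.tendsto_exp_atTop.comp
          (tendsto_id.atTop_mul_const (sub_pos.2 hτ.2))).const_mul_atTop hε0
      exact ((eventually_gt_atTop 0).and (h1.eventually_ge_atTop M)).exists
    set θ : ℝ → ℝ := fun σ => ε * Real.exp (k * (σ - τ)) with hθ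
    have hθ0 : ∀ σ, 0 < θ σ := fun σ => by positivity
    have hθd : ∀ σ, HasDerivAt θ (ε * (Real.exp (k * (σ - τ)) * k)) σ := fun σ => by
      simpa using ((((hasDerivAt_id σ).sub_const τ).const_mul k).exp).const_mul ε
    have hθc : ContDiff ℝ 1 θ := by fun_prop
    have hcont2 : ContinuousOn (fun p : Euc N × ℝ => v p.1 p.2 - (φ p.1 p.2 + θ p.2))
        (closedBall x r ×ˢ Icc s t) := by
      have : ContinuousOn (fun p : Euc N × ℝ => θ p.2) (closedBall x r ×ˢ Icc s t) :=
        (hθc.continuous.comp continuous_snd).continuousOn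
      exact (hcont.sub this).congr fun p _ => (sub_sub _ _ _).symm
    obtain ⟨⟨z0, τ0⟩, ⟨hz0, hτ0⟩, hmax⟩ := hK.exists_isMaxOn ⟨_, hzτ⟩ hcont2
    simp only at hz0 hτ0
    have hpos : 0 < v z0 τ0 - (φ z0 τ0 + θ τ0) := by
      have h1 : v z τ - (φ z τ + θ τ) ≤ v z0 τ0 - (φ z0 τ0 + θ τ0) := hmax hzτ
      have h2 : θ τ = ε := by simp [hθ]
      have : v z τ - φ z τ = 2 * ε := by rw [hε]; ring
      linarith
    have hτs : s < τ0 := by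
      rcases hτ0.1.eq_or_lt with h | h
      · have := hinit z0 hz0
        rw [h] at this
        linarith [hθ0 τ0]
      · exact h
    have hτt : τ0 < t := by
      rcases hτ0.2.eq_or_lt with h | h
      · have h1 := hM' z0 hz0 τ0 hτ0
        have h2 : M ≤ θ τ0 := by rw [h]; exact hk
        linarith
      · exact h
    have hzb : z0 ∈ ball x r := by
      rcases (mem_closedBall.1 hz0).eq_or_lt with h | h
      · have := hlat z0 (mem_sphere.2 h) τ0 hτ0
        linarith [hθ0 τ0]
      · exact h
    have hφθ : ContDiff ℝ 1 (fun p : Euc N × ℝ => φ p.1 p.2 + θ p.2) :=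
      hφ.add (hθc.comp contDiff_snd)
    have hloc : IsLocalMax (fun p : Euc N × ℝ => v p.1 p.2 - (φ p.1 p.2 + θ p.2)) (z0, τ0) :=
      hmax.isLocalMax (prod_mem_nhds (closedBall_mem_nhds_of_mem hzb) (Icc_mem_nhds hτs hτt))
    have key := hsub (fun y σ => φ y σ + θ σ) hφθ z0 τ0
      ⟨hs.trans_lt hτs, hτt.trans_le htT⟩ (hloc.on _)
    have hφd : DifferentiableAt ℝ (φ z0) τ0 := by
      have : Differentiable ℝ (fun σ => φ z0 σ) :=
        (hφ.differentiable one_ne_zero).comp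
          ((differentiable_const z0).prodMk differentiable_id)
      exact this τ0
    have e1 : deriv (fun σ => φ z0 σ + θ σ) τ0
        = deriv (φ z0) τ0 + ε * (Real.exp (k * (τ0 - τ)) * k) := by
      rw [deriv_fun_add hφd (hθd τ0).differentiableAt, (hθd τ0).deriv]
    have e2 : gradient (fun y => φ y τ0 + θ τ0) z0 = gradient (fun y => φ y τ0) z0 := by
      simp [gradient, fderiv_add_const]
    simp only [e2] at key
    rw [e1] at key
    have h3 := hsup z0 hzb τ0 ⟨hτs, hτt⟩
    have : 0 < ε * (Real.exp (k * (τ0 - τ)) * k) := by positivity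
    linarith
  intro z hz τ hτ
  have hcz : ContinuousOn (fun σ => v z σ - φ z σ) (Icc s t) :=
    hcont.comp (f := fun σ : ℝ => (z, σ)) (by fun_prop) fun σ hσ => ⟨hz, hσ⟩
  have hcl : closure (Ico s t) = Icc s t := closure_Ico hst.ne
  have hmem : v z τ - φ z τ ∈ Iic (0 : ℝ) := by
    rw [← hcl] at hcz hτ
    have := hcz.image_closure (mem_image_of_mem _ hτ)
    refine closure_minimal ?_ isClosed_Iic this
    rintro _ ⟨σ, hσ, rfl⟩
    exact sub_nonpos.2 (hlt z hz σ hσ)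
  exact sub_nonpos.1 hmem

lemma contDiff_one_integral {γ : ℝ → ℝ} (hγ : Continuous γ) (s : ℝ) :
    ContDiff ℝ 1 (fun τ => ∫ σ in s..τ, γ σ) := by
  have hd : ∀ τ, HasDerivAt (fun τ => ∫ σ in s..τ, γ σ) (γ τ) τ := fun τ =>
    (hγ.integral_hasStrictDerivAt s τ).hasDerivAt
  refine contDiff_one_iff_deriv.2 ⟨fun τ => (hd τ).differentiableAt, ?_⟩
  rwa [show deriv (fun τ => ∫ σ in s..τ, γ σ) = γ from funext fun τ => (hd τ).deriv]

/-- Finite speed of propagation: upper bounds on a large ball persist at its centre. -/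
lemma IsSubsolution.le_of_le_closedBall {N : ℕ} {T : ℝ} {c v : Euc N → ℝ → ℝ}
    (hsub : IsSubsolution T c v)
    (hv : ContinuousOn (fun p : Euc N × ℝ => v p.1 p.2)
      ((Set.univ : Set (Euc N)) ×ˢ Set.Icc (0 : ℝ) T))
    {s t r a : ℝ} (hs : 0 ≤ s) (hst : s < t) (htT : t ≤ T) {x : Euc N}
    {γ : ℝ → ℝ} (hγ : Continuous γ) (hγ0 : ∀ τ, 0 ≤ γ τ)
    (hcγ : ∀ z ∈ ball x r, ∀ τ ∈ Ioo s t, c z τ ≤ γ τ)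
    (hγr : ∫ σ in s..t, γ σ < r)
    (ha : ∀ z ∈ closedBall x r, v z s ≤ a) : v x t ≤ a := by
  set Γ : ℝ → ℝ := fun τ => ∫ σ in s..τ, γ σ with hΓ
  have hΓd : ∀ τ, HasDerivAt Γ (γ τ) τ := fun τ =>
    (hγ.integral_hasStrictDerivAt s τ).hasDerivAt
  have hΓc : ContDiff ℝ 1 Γ := contDiff_one_integral hγ s
  have hΓ0 : ∀ τ, s ≤ τ → 0 ≤ Γ τ := fun τ hτ =>
    intervalIntegral.integral_nonneg hτ fun σ _ => hγ0 σ
  have hr : 0 < r := (hΓ0 t hst.le).trans_lt hγr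
  set κ : ℝ := (r - Γ t) / 2 with hκ
  have hκ0 : 0 < κ := by
    rw [hκ]; have : Γ t < r := hγr
    linarith
  set q : ℝ := Γ t + κ with hq
  have hqr : q < r := by rw [hq]; linarith
  refine le_of_forall_pos_le_add fun ε hε => ?_
  have hK : IsCompact (closedBall x r ×ˢ Icc s t) :=
    (isCompact_closedBall x r).prod isCompact_Icc
  obtain ⟨M, hM⟩ := hK.bddAbove_image
    (hv.mono (prod_mono (subset_univ _) (Icc_subset_Icc hs htT)))
  have hM' : ∀ y ∈ closedBall x r, ∀ σ ∈ Icc s t, v y σ ≤ M := fun y hy σ hσ =>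
    hM (mem_image_of_mem (fun p : Euc N × ℝ => v p.1 p.2) (mk_mem_prod hy hσ))
  obtain ⟨k, hk0, hk⟩ : ∃ k : ℝ, 0 < k ∧ M - a ≤ ε * Real.exp (k * (r - q)) := by
    have h1 : Tendsto (fun k : ℝ => ε * Real.exp (k * (r - q))) atTop atTop :=
      (Real.tendsto_exp_atTop.comp
        (tendsto_id.atTop_mul_const (sub_pos.2 hqr))).const_mul_atTop hε
    exact ((eventually_gt_atTop 0).and (h1.eventually_ge_atTop (M - a))).exists
  set F : ℝ → ℝ → ℝ := fun τ w => a + ε * Real.exp (k * (Real.sqrt (w + κ ^ 2) + Γ τ - q))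
    with hF
  have hpos : ∀ z : Euc N, 0 < ‖z - x‖ ^ 2 + κ ^ 2 := fun z => by positivity
  have hFc : ContDiff ℝ 1 (fun p : Euc N × ℝ => F p.2 (‖p.1 - x‖ ^ 2)) := by
    have h1 : ContDiff ℝ 1 (fun p : Euc N × ℝ => Real.sqrt (‖p.1 - x‖ ^ 2 + κ ^ 2)) :=
      (((contDiff_fst.sub contDiff_const).norm_sq ℝ).add contDiff_const).sqrt
        fun p => (hpos p.1).ne'
    have h2 : ContDiff ℝ 1 (fun p : Euc N × ℝ => Γ p.2) := hΓc.comp contDiff_snd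
    exact contDiff_const.add (contDiff_const.mul
      (contDiff_const.mul ((h1.add h2).sub contDiff_const)).exp)
  have key := hsub.le_of_boundary hv hs hst htT (x := x) (r := r)
    (φ := fun z τ => F τ (‖z - x‖ ^ 2)) hFc ?_ ?_ ?_ x (mem_closedBall_self hr.le) t
    (right_mem_Icc.2 hst.le)
  · refine key.trans ?_
    have : Real.sqrt (‖x - x‖ ^ 2 + κ ^ 2) = κ := by simp [Real.sqrt_sq hκ0.le]
    simp only [hF]
    rw [this]
    have : k * (κ + Γ t - q) = 0 := by rw [hq]; ring
    rw [this, Real.exp_zero, mul_one]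
  · intro z hz τ hτ
    set S := Real.sqrt (‖z - x‖ ^ 2 + κ ^ 2) with hS
    have hS0 : 0 < S := Real.sqrt_pos.2 (hpos z)
    have hzS : ‖z - x‖ ≤ S := Real.le_sqrt_of_sq_le (by nlinarith)
    set P := ε * (Real.exp (k * (S + Γ τ - q)) * k) with hP
    have hP0 : 0 < P := by positivity
    have hdt : HasDerivAt (fun τ => F τ (‖z - x‖ ^ 2)) (P * γ τ) τ := by
      have := ((((((hΓd τ).const_add S).sub_const q).const_mul k).exp).const_mul ε).const_add a
      refine this.congr_deriv ?_
      rw [hP]; ring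
    have hdw : HasDerivAt (F τ) (P * (1 / (2 * S))) (‖z - x‖ ^ 2) := by
      have h1 : HasDerivAt (fun w : ℝ => Real.sqrt (w + κ ^ 2)) (1 / (2 * S)) (‖z - x‖ ^ 2) :=
        ((hasDerivAt_id _).add_const _).sqrt (hpos z).ne'
      have := (((((h1.add_const (Γ τ)).sub_const q).const_mul k).exp).const_mul ε).const_add a
      refine this.congr_deriv ?_
      rw [hP]; ring
    rw [hdt.deriv, norm_gradient_radial hdw, abs_of_pos (by positivity)]
    have h1 : P * (1 / (2 * S)) * (2 * ‖z - x‖) = P * (‖z - x‖ / S) := by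
      field_simp
    have h2 : ‖z - x‖ / S ≤ 1 := (div_le_one hS0).2 hzS
    rw [h1]
    calc c z τ * (P * (‖z - x‖ / S)) ≤ γ τ * (P * (‖z - x‖ / S)) :=
          mul_le_mul_of_nonneg_right (hcγ z hz τ hτ) (by positivity)
      _ ≤ γ τ * (P * 1) := by
          refine mul_le_mul_of_nonneg_left ?_ (hγ0 τ)
          exact mul_le_mul_of_nonneg_left h2 hP0.le
      _ = P * γ τ := by ring
  · intro z hz
    refine (ha z hz).trans ?_
    simp only [hF]
    have : 0 < ε * Real.exp (k * (Real.sqrt (‖z - x‖ ^ 2 + κ ^ 2) + Γ s - q)) := by positivity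
    linarith
  · intro z hz τ hτ
    refine (hM' z (sphere_subset_closedBall hz) τ hτ).trans ?_
    have hzr : ‖z - x‖ = r := by rw [← dist_eq_norm]; exact hz
    have h1 : r ≤ Real.sqrt (‖z - x‖ ^ 2 + κ ^ 2) :=
      Real.le_sqrt_of_sq_le (by rw [hzr]; nlinarith)
    have h2 : ε * Real.exp (k * (r - q))
        ≤ ε * Real.exp (k * (Real.sqrt (‖z - x‖ ^ 2 + κ ^ 2) + Γ τ - q)) := by
      have := hΓ0 τ hτ.1
      gcongr
      linarith
    simp only [hF]
    linarith

/-- Where the velocity is at least `γ ≥ 0`, superlevel sets of a supersolution grow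
with speed at least `γ`. -/
lemma IsSubsolution.le_of_growth {N : ℕ} {T : ℝ} {c v : Euc N → ℝ → ℝ}
    (hsub : IsSubsolution T (fun z τ => -c z τ) v)
    (hv : ContinuousOn (fun p : Euc N × ℝ => v p.1 p.2)
      ((Set.univ : Set (Euc N)) ×ˢ Set.Icc (0 : ℝ) T))
    {s t r : ℝ} (hs : 0 ≤ s) (hst : s < t) (htT : t ≤ T) {y : Euc N}
    {γ : ℝ → ℝ} (hγ : Continuous γ) (hγ0 : ∀ τ, 0 ≤ γ τ)
    (hcγ : ∀ z ∈ ball y r, ∀ τ ∈ Ioo s t, γ τ ≤ c z τ)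
    (hγr : ∫ σ in s..t, γ σ < r) {z : Euc N}
    (hz : ‖z - y‖ ≤ ∫ σ in s..t, γ σ) : v z t ≤ v y s := by
  set Γ : ℝ → ℝ := fun τ => ∫ σ in s..τ, γ σ with hΓ
  have hΓd : ∀ τ, HasDerivAt Γ (γ τ) τ := fun τ =>
    (hγ.integral_hasStrictDerivAt s τ).hasDerivAt
  have hΓc : ContDiff ℝ 1 Γ := contDiff_one_integral hγ s
  have hΓmono : Monotone Γ := monotone_of_hasDerivAt_nonneg hΓd hγ0
  have hΓs : Γ s = 0 := by simp [hΓ]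
  have hΓ0 : ∀ τ, s ≤ τ → 0 ≤ Γ τ := fun τ hτ => hΓs ▸ hΓmono hτ
  have hr : Γ t < r := hγr
  have hr0 : 0 < r := (hΓ0 t hst.le).trans_lt hγr
  refine le_of_forall_pos_le_add fun ε hε => ?_
  have hvs : ContinuousOn (fun z => v z s) univ :=
    hv.comp (f := fun z : Euc N => (z, s)) (by fun_prop)
      fun z _ => ⟨mem_univ _, hs, hst.le.trans htT⟩
  obtain ⟨δ, hδ0, hδ⟩ : ∃ δ > 0, ∀ z, ‖z - y‖ < δ → v z s ≤ v y s + ε := by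
    have h1 : ∀ᶠ z in 𝓝 y, v z s < v y s + ε :=
      ((continuousOn_univ.1 hvs).tendsto y).eventually_lt_const (by linarith)
    obtain ⟨δ, hδ0, hδ⟩ := Metric.eventually_nhds_iff.1 h1
    exact ⟨δ, hδ0, fun z hz => (hδ (by rwa [dist_eq_norm])).le⟩
  obtain ⟨κ, hκ0, hκr, hκδ⟩ : ∃ κ > 0, κ + Γ t < r ∧ 2 * κ ≤ δ := by
    refine ⟨min (δ / 2) ((r - Γ t) / 2), lt_min (by linarith) (by linarith), ?_, ?_⟩
    · linarith [min_le_right (δ / 2) ((r - Γ t) / 2)]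
    · linarith [min_le_left (δ / 2) ((r - Γ t) / 2)]
  set E := expNegInvGlue with hE
  have hEc : ContDiff ℝ 1 E := expNegInvGlue.contDiff (n := 1)
  have hEd : ∀ w, HasDerivAt E (deriv E w) w := fun w =>
    (hEc.differentiable one_ne_zero w).hasDerivAt
  have hE'0 : ∀ w, 0 ≤ deriv E w := fun w => expNegInvGlue.monotone.deriv_nonneg
  have hEneg : ∀ w < 0, deriv E w = 0 := by
    intro w hw
    have : E =ᶠ[𝓝 w] fun _ => 0 := by
      filter_upwards [Iio_mem_nhds hw] with w' hw'
      exact expNegInvGlue.zero_of_nonpos (le_of_lt hw')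
    rw [this.deriv_eq]; simp
  have hK : IsCompact (closedBall y r ×ˢ Icc s t) :=
    (isCompact_closedBall y r).prod isCompact_Icc
  obtain ⟨M, hM⟩ := hK.bddAbove_image
    (hv.mono (prod_mono (subset_univ _) (Icc_subset_Icc hs htT)))
  have hM' : ∀ z ∈ closedBall y r, ∀ σ ∈ Icc s t, v z σ ≤ M := fun z hz σ hσ =>
    hM (mem_image_of_mem (fun p : Euc N × ℝ => v p.1 p.2) (mk_mem_prod hz hσ))
  set a := v y s + ε with ha
  obtain ⟨m, hm0, hm1, hm2⟩ : ∃ m > 0, m ≤ 3 * κ ^ 2 ∧ m ≤ r ^ 2 - (κ + Γ t) ^ 2 := by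
    have h1 : 0 < r ^ 2 - (κ + Γ t) ^ 2 := by
      have := hΓ0 t hst.le
      nlinarith
    exact ⟨min (3 * κ ^ 2) (r ^ 2 - (κ + Γ t) ^ 2), lt_min (by positivity) h1,
      min_le_left _ _, min_le_right _ _⟩
  have hEm : 0 < E m := expNegInvGlue.pos_of_pos hm0
  set B : ℝ := |M - a| / E m with hB
  have hB0 : 0 ≤ B := by positivity
  have hBM : ∀ w, m ≤ w → M ≤ a + B * E w := by
    intro w hw
    have h1 : B * E m ≤ B * E w :=
      mul_le_mul_of_nonneg_left (expNegInvGlue.monotone hw) hB0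
    have h2 : B * E m = |M - a| := div_mul_cancel₀ _ hEm.ne'
    linarith [le_abs_self (M - a)]
  set F : ℝ → ℝ → ℝ := fun τ w => a + B * E (w - (κ + Γ τ) ^ 2) with hF
  have hFc : ContDiff ℝ 1 (fun p : Euc N × ℝ => F p.2 (‖p.1 - y‖ ^ 2)) := by
    have h1 : ContDiff ℝ 1 (fun p : Euc N × ℝ => ‖p.1 - y‖ ^ 2) :=
      (contDiff_fst.sub contDiff_const).norm_sq ℝ
    have h2 : ContDiff ℝ 1 (fun p : Euc N × ℝ => Γ p.2) := hΓc.comp contDiff_snd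
    exact contDiff_const.add (contDiff_const.mul
      (hEc.comp (h1.sub ((contDiff_const.add h2).pow 2))))
  have hzr : z ∈ closedBall y r := by
    rw [mem_closedBall, dist_eq_norm]; exact hz.trans hr.le
  have key := hsub.le_of_boundary hv hs hst htT (x := y) (r := r)
    (φ := fun z τ => F τ (‖z - y‖ ^ 2)) hFc ?_ ?_ ?_ z hzr t (right_mem_Icc.2 hst.le)
  · refine key.trans ?_
    have hz' : ‖z - y‖ ≤ Γ t := hz
    have : E (‖z - y‖ ^ 2 - (κ + Γ t) ^ 2) = 0 := by
      apply expNegInvGlue.zero_of_nonpos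
      have := norm_nonneg (z - y)
      nlinarith
    simp only [hF]
    rw [this]; simp
  · intro z hz τ hτ
    set w := ‖z - y‖ ^ 2 - (κ + Γ τ) ^ 2 with hw
    have hdt : HasDerivAt (fun τ => F τ (‖z - y‖ ^ 2))
        (-(B * deriv E w * (2 * (κ + Γ τ) * γ τ))) τ := by
      have h1 : HasDerivAt (fun τ => ‖z - y‖ ^ 2 - (κ + Γ τ) ^ 2)
          (-(2 * (κ + Γ τ) * γ τ)) τ := by
        have := (((hΓd τ).const_add κ).pow 2).const_sub (‖z - y‖ ^ 2)
        refine this.congr_deriv ?_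
        simp
      have := (((hEd w).comp τ h1).const_mul B).const_add a
      refine this.congr_deriv ?_
      ring
    have hdw : HasDerivAt (F τ) (B * deriv E w) (‖z - y‖ ^ 2) := by
      have h1 : HasDerivAt (fun w : ℝ => w - (κ + Γ τ) ^ 2) 1 (‖z - y‖ ^ 2) :=
        (hasDerivAt_id _).sub_const _
      have := (((hEd w).comp (‖z - y‖ ^ 2) h1).const_mul B).const_add a
      refine this.congr_deriv ?_
      ring
    rw [hdt.deriv, norm_gradient_radial hdw,
      abs_of_nonneg (mul_nonneg hB0 (hE'0 w))]
    rcases lt_or_ge w 0 with hneg | hpos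
    · simp [hEneg w hneg]
    · have hΓτ := hΓ0 τ hτ.1.le
      have h1 : κ + Γ τ ≤ ‖z - y‖ := by
        refine abs_le_of_sq_le_sq' ?_ (norm_nonneg _) |>.2
        linarith
      have h2 : (κ + Γ τ) * γ τ ≤ ‖z - y‖ * c z τ :=
        mul_le_mul h1 (hcγ z hz τ hτ) (hγ0 τ) (norm_nonneg _)
      have h3 := mul_le_mul_of_nonneg_left h2 (mul_nonneg hB0 (hE'0 w))
      nlinarith
  · intro z hz
    simp only [hF, hΓs, add_zero]
    rcases lt_or_ge ‖z - y‖ δ with hlt | hge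
    · refine (hδ z hlt).trans ?_
      have : 0 ≤ B * E (‖z - y‖ ^ 2 - κ ^ 2) := mul_nonneg hB0 (expNegInvGlue.nonneg _)
      linarith
    · refine (hM' z hz s (left_mem_Icc.2 hst.le)).trans (hBM _ ?_)
      nlinarith
  · intro z hz τ hτ
    have hzr : ‖z - y‖ = r := by rw [← dist_eq_norm]; exact hz
    refine (hM' z (sphere_subset_closedBall hz) τ hτ).trans (hBM _ ?_)
    have h1 := hΓ0 τ hτ.1
    have h2 := hΓmono hτ.2
    rw [hzr]
    nlinarith

lemma measure_eq_zero_of_porous {N : ℕ} {Z : Set (Euc N)} (K : ℝ)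
    (h : ∀ x ∈ Z, ∀ ε > 0, ∃ y δ, 0 < δ ∧ δ < ε ∧ x ∈ closedBall y (K * δ) ∧
      Disjoint Z (closedBall y δ)) : volume Z = 0 := by
  have hae := IsUnifLocDoublingMeasure.ae_tendsto_measure_inter_div.{_, 0}
    (volume : Measure (Euc N)) Z K
  refine le_antisymm ?_ zero_le
  rw [← Measure.restrict_apply_self (volume : Measure (Euc N)) Z]
  refine (measure_mono fun x hx => ?_).trans (le_of_eq (ae_iff.1 hae))
  simp only [mem_ofPred_eq]
  intro hlim
  choose y δ hδ0 hδ hxy hdisj using fun n : ℕ => h x hx (1 / ((n : ℝ) + 1)) (by positivity)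
  have hδlim : Tendsto δ atTop (𝓝[>] 0) := by
    refine tendsto_nhdsWithin_iff.2 ⟨?_, Eventually.of_forall hδ0⟩
    exact squeeze_zero (fun n => (hδ0 n).le) (fun n => (hδ n).le)
      tendsto_one_div_add_atTop_nhds_zero_nat
  have := hlim y δ hδlim (Eventually.of_forall hxy)
  simp only [(hdisj _).inter_eq, measure_empty, ENNReal.zero_div] at this
  exact zero_ne_one (tendsto_nhds_unique tendsto_const_nhds this)

/-- The points reached by the front exactly at time `t` form a null set. -/
lemma volume_arrival_eq_zero {N : ℕ} {T : ℝ} (hT : 0 < T) {c u : Euc N → ℝ → ℝ}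
    {u0 : Euc N → ℝ} (hsol : IsViscositySolution N T c u u0)
    (hu : ContinuousOn (fun p : Euc N × ℝ => u p.1 p.2)
      ((Set.univ : Set (Euc N)) ×ˢ Set.Icc (0 : ℝ) T))
    {L : ℝ} (hL : 0 < L)
    (hcL : ∀ x y : Euc N, ∀ t ∈ Icc (0 : ℝ) T, |c x t - c y t| ≤ L * ‖x - y‖)
    (hc0 : ∀ x : Euc N, ∀ t ∈ Icc (0 : ℝ) T, 0 ≤ c x t)
    (hcc : ∀ x : Euc N, ContinuousOn (c x) (Icc 0 T))
    {t : ℝ} (ht : 0 < t) (htT : t ≤ T) :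
    volume {x : Euc N | 0 ≤ u x t ∧ ∀ s ∈ Ico 0 t, u x s < 0} = 0 := by
  refine measure_eq_zero_of_porous 8 fun x hx ε hε => ?_
  set g : ℝ → ℝ := IccExtend hT.le (domRestrict (Icc 0 T) (c x)) with hg
  have hgc : Continuous g := (continuousOn_iff_continuous_domRestrict.1 (hcc x)).Icc_extend'
  have hgeq : ∀ τ ∈ Icc 0 T, g τ = c x τ := fun τ hτ => IccExtend_of_mem _ _ hτ
  have hg0 : ∀ τ, 0 ≤ g τ := fun τ => hc0 x _ (projIcc 0 T hT.le τ).2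
  have hgi : ∀ a b, IntervalIntegrable g volume a b := fun a b => hgc.intervalIntegrable a b
  have hprim : ∀ a, Continuous fun τ => ∫ σ in a..τ, g σ := fun a =>
    intervalIntegral.continuous_primitive hgi a
  obtain ⟨s, hst, hs0, hsL, hsε⟩ : ∃ s < t, 0 < s ∧ t - s < 1 / (8 * L) ∧
      ∫ σ in s..t, g σ < ε := by
    have h1 : Tendsto (fun s => ∫ σ in s..t, g σ) (𝓝[<] t) (𝓝 0) := by
      have h2 : Continuous fun s => ∫ σ in s..t, g σ := by
        have := (hprim t).neg
        refine this.congr fun s => ?_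
        rw [intervalIntegral.integral_symm]; simp
      have h3 := h2.tendsto t
      rw [intervalIntegral.integral_same] at h3
      exact h3.mono_left nhdsWithin_le_nhds
    have h2 : t - 1 / (8 * L) < t := by
      have : 0 < 1 / (8 * L) := by positivity
      linarith
    have e1 : ∀ᶠ s in 𝓝[<] t, s ∈ Ioo 0 t := Ioo_mem_nhdsLT ht
    have e2 : ∀ᶠ s in 𝓝[<] t, s ∈ Ioo (t - 1 / (8 * L)) t := Ioo_mem_nhdsLT h2
    obtain ⟨s, h3, h4, h5⟩ := ((h1.eventually_lt_const hε).and (e1.and e2)).exists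
    exact ⟨s, h4.2, h4.1, by linarith [h5.1], h3⟩
  have hsL' : L * (t - s) < 1 / 8 := by
    rw [lt_div_iff₀ (by positivity)] at hsL
    linarith
  have hτT : ∀ τ ∈ Ioo s t, τ ∈ Icc 0 T := fun τ hτ =>
    ⟨hs0.le.trans hτ.1.le, hτ.2.le.trans htT⟩
  have hsI : s ∈ Icc 0 T := ⟨hs0.le, hst.le.trans htT⟩
  have hus : Continuous fun z => u z s :=
    continuousOn_univ.1 (hu.comp (f := fun z : Euc N => (z, s)) (by fun_prop)
      fun z _ => ⟨mem_univ _, hsI⟩)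
  set h : ℝ := ∫ σ in s..t, g σ with hh
  have hh0 : 0 ≤ h := intervalIntegral.integral_nonneg hst.le fun σ _ => hg0 σ
  have hback : ∀ r a : ℝ, 0 < r → h + r / 8 < r → (∀ z ∈ closedBall x r, u z s ≤ a) →
      u x t ≤ a := by
    intro r a hr hhr hza
    refine hsol.isSubsolution.le_of_le_closedBall hu hs0.le hst htT
      (γ := fun τ => g τ + L * r) (hgc.add continuous_const)
      (fun τ => add_nonneg (hg0 τ) (by positivity)) ?_ ?_ hza
    · intro z hz τ hτ
      have h1 := le_of_abs_le (hcL z x τ (hτT τ hτ))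
      have h2 : L * ‖z - x‖ ≤ L * r :=
        mul_le_mul_of_nonneg_left (mem_ball_iff_norm.1 hz).le hL.le
      rw [hgeq τ (hτT τ hτ)]
      linarith
    · rw [intervalIntegral.integral_add (hgi s t) (by simp), intervalIntegral.integral_const,
        smul_eq_mul]
      nlinarith
  have hxs : u x s < 0 := hx.2 s ⟨hs0.le, hst⟩
  have hhpos : 0 < h := by
    refine hh0.lt_of_ne fun hh' => ?_
    obtain ⟨r, hr, hball⟩ := Metric.nhds_basis_closedBall.eventually_iff.1
      (hus.continuousAt.eventually_lt_const (show u x s < u x s / 2 by linarith))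
    have := hback r (u x s / 2) hr (by rw [← hh']; linarith) fun z hz => (hball hz).le
    linarith [hx.1]
  obtain ⟨y, hy, hys⟩ : ∃ y ∈ closedBall x (2 * h), 0 ≤ u y s := by
    obtain ⟨y, hy, hmax⟩ := (isCompact_closedBall x (2 * h)).exists_isMaxOn
      ⟨x, mem_closedBall_self (by positivity)⟩ hus.continuousOn
    refine ⟨y, hy, hx.1.trans (hback (2 * h) _ (by positivity) (by linarith) hmax)⟩
  obtain ⟨t', hst', ht't, ht'⟩ : ∃ t', s < t' ∧ t' < t ∧ 3 / 4 * h < ∫ σ in s..t', g σ := by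
    have h1 : ∀ᶠ τ in 𝓝[<] t, 3 / 4 * h < ∫ σ in s..τ, g σ :=
      (((hprim s).tendsto t).mono_left nhdsWithin_le_nhds).eventually_const_lt (by linarith)
    obtain ⟨τ, h2, h3⟩ := (h1.and (show ∀ᶠ τ in 𝓝[<] t, τ ∈ Ioo s t from Ioo_mem_nhdsLT hst)).exists
    exact ⟨τ, h3.1, h3.2, h2⟩
  have hle : ∫ σ in s..t', g σ ≤ h := by
    have h1 := intervalIntegral.integral_add_adjacent_intervals (hgi s t') (hgi t' t)
    have h2 : 0 ≤ ∫ σ in t'..t, g σ :=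
      intervalIntegral.integral_nonneg ht't.le fun σ _ => hg0 σ
    linarith
  set γ : ℝ → ℝ := fun τ => max (g τ - 4 * L * h) 0 with hγ
  have hγc : Continuous γ := (hgc.sub continuous_const).max continuous_const
  have hγup : ∫ σ in s..t', γ σ ≤ h := by
    refine (intervalIntegral.integral_mono_on hst'.le (hγc.intervalIntegrable _ _)
      (hgi s t') fun τ _ => ?_).trans hle
    exact max_le (by have : 0 ≤ 4 * L * h := by positivity
                     linarith) (hg0 τ)
  have hγlow : h / 4 ≤ ∫ σ in s..t', γ σ := by
    have h1 : ∫ σ in s..t', (g σ - 4 * L * h) ≤ ∫ σ in s..t', γ σ :=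
      intervalIntegral.integral_mono_on hst'.le ((hgi s t').sub (by simp))
        (hγc.intervalIntegrable _ _) fun τ _ => le_max_left _ _
    rw [intervalIntegral.integral_sub (hgi s t') (by simp), intervalIntegral.integral_const,
      smul_eq_mul] at h1
    have h2 : (t' - s) * (4 * L * h) ≤ h / 2 := by
      have : L * (t' - s) ≤ 1 / 8 := by nlinarith
      nlinarith
    linarith
  refine ⟨y, h / 4, by positivity, by linarith, ?_, ?_⟩
  · rw [mem_closedBall_comm]
    convert hy using 2
    ring
  · refine Set.disjoint_left.2 fun z hzZ hzy => ?_
    have hzt' := hzZ.2 t' ⟨hs0.le.trans hst'.le, ht't⟩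
    have hgrow : -u z t' ≤ -u y s := by
      refine hsol.isSubsolution_neg.le_of_growth (v := fun z τ => -u z τ) hu.neg hs0.le hst'
        (ht't.le.trans htT) (r := 2 * h) hγc (fun τ => le_max_right _ _) ?_ (by linarith)
        ((mem_closedBall_iff_norm.1 hzy).trans hγlow)
      intro w hw τ hτ
      have hτI := hτT τ ⟨hτ.1, hτ.2.trans ht't⟩
      refine max_le ?_ (hc0 w τ hτI)
      have h1 := le_of_abs_le (hcL x w τ hτI)
      have h2 : ‖x - w‖ ≤ 4 * h := by
        have h3 := dist_triangle w y x
        have h4 := mem_closedBall.1 hy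
        have h5 := mem_ball.1 hw
        rw [← dist_eq_norm, dist_comm]
        linarith
      have h3 : L * ‖x - w‖ ≤ L * (4 * h) := mul_le_mul_of_nonneg_left h2 hL.le
      rw [hgeq τ hτI]
      linarith
    linarith

section Velocity

variable {N : ℕ} {T : ℝ} {c0 c1 ρ : Euc N → ℝ → ℝ} {L1 L1' : ℝ}

lemma exists_integral_abs_le (hT : 0 < T)
    (hρint : ∀ t ∈ Set.Icc (0 : ℝ) T, Integrable (fun y => ρ y t))
    (hρcont : ∀ t ∈ Set.Icc (0 : ℝ) T,
      Tendsto (fun s => ∫ y : Euc N, |ρ y s - ρ y t|) (𝓝[Set.Icc (0 : ℝ) T] t) (𝓝 0)) :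
    ∃ P : ℝ, 0 ≤ P ∧ ∀ t ∈ Icc (0 : ℝ) T, ∫ y : Euc N, |ρ y t| ≤ P := by
  have hcont : ContinuousOn (fun t => ∫ y : Euc N, |ρ y t|) (Icc 0 T) := by
    intro t ht
    rw [ContinuousWithinAt, tendsto_iff_norm_sub_tendsto_zero]
    refine squeeze_zero' (Eventually.of_forall fun s => norm_nonneg _) ?_ (hρcont t ht)
    filter_upwards [self_mem_nhdsWithin] with s hs
    rw [← integral_sub (hρint s hs).abs (hρint t ht).abs]
    refine (norm_integral_le_integral_norm _).trans ?_
    refine integral_mono ((hρint s hs).abs.sub (hρint t ht).abs).norm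
      ((hρint s hs).sub (hρint t ht)).abs fun y => ?_
    exact abs_abs_sub_abs_le_abs_sub _ _
  obtain ⟨P, hP⟩ := isCompact_Icc.bddAbove_image hcont
  have hP' : ∀ t ∈ Icc (0 : ℝ) T, ∫ y : Euc N, |ρ y t| ≤ P := fun t ht =>
    hP (mem_image_of_mem (fun t => ∫ y : Euc N, |ρ y t|) ht)
  exact ⟨P, (integral_nonneg fun y => abs_nonneg _).trans (hP' 0 (left_mem_Icc.2 hT.le)), hP'⟩

lemma continuous_of_lipschitz_slice (hL1 : 0 < L1)
    (hH1c0 : ∀ x y : Euc N, ∀ t ∈ Set.Icc (0 : ℝ) T,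
      |c0 x t - c0 y t| ≤ L1 * ‖x - y‖ ∧ |c0 x t| ≤ L1')
    {t : ℝ} (ht : t ∈ Icc 0 T) : Continuous fun y => c0 y t := by
  refine (LipschitzWith.of_dist_le_mul (K := ⟨L1, hL1.le⟩) fun x y => ?_).continuous
  rw [Real.dist_eq, dist_eq_norm]
  exact (hH1c0 x y t ht).1

lemma integrable_translate_mul (hL1 : 0 < L1)
    (hH1c0 : ∀ x y : Euc N, ∀ t ∈ Set.Icc (0 : ℝ) T,
      |c0 x t - c0 y t| ≤ L1 * ‖x - y‖ ∧ |c0 x t| ≤ L1')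
    {f : Euc N → ℝ} (hf : Integrable f) (x : Euc N) {t : ℝ} (ht : t ∈ Icc 0 T) :
    Integrable (fun y => c0 (y - x) t * f y) :=
  hf.bdd_mul (c := L1') ((continuous_of_lipschitz_slice hL1 hH1c0 ht).comp
    (continuous_id.sub continuous_const)).aestronglyMeasurable
    (Eventually.of_forall fun y => (hH1c0 (y - x) 0 t ht).2)

lemma abs_convVel_sub_le (hL1 : 0 < L1)
    (hH1c0 : ∀ x y : Euc N, ∀ t ∈ Set.Icc (0 : ℝ) T,
      |c0 x t - c0 y t| ≤ L1 * ‖x - y‖ ∧ |c0 x t| ≤ L1')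
    (hH1c1 : ∀ x y : Euc N, ∀ t ∈ Set.Icc (0 : ℝ) T,
      |c1 x t - c1 y t| ≤ L1 * ‖x - y‖ ∧ |c1 x t| ≤ L1')
    (hρint : ∀ t ∈ Set.Icc (0 : ℝ) T, Integrable (fun y => ρ y t))
    {P : ℝ} (hP : ∀ t ∈ Icc (0 : ℝ) T, ∫ y : Euc N, |ρ y t| ≤ P)
    (x z : Euc N) {t : ℝ} (ht : t ∈ Icc 0 T) :
    |convVel c0 c1 ρ x t - convVel c0 c1 ρ z t| ≤ L1 * (P + 1) * ‖x - z‖ := by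
  have hi := fun x => integrable_translate_mul hL1 hH1c0 (hρint t ht) x ht
  have h1 : |(∫ y : Euc N, c0 (y - x) t * ρ y t) - ∫ y : Euc N, c0 (y - z) t * ρ y t|
      ≤ L1 * ‖x - z‖ * P := by
    rw [← integral_sub (hi x) (hi z)]
    refine (abs_integral_le_integral_abs).trans ?_
    refine (integral_mono ((hi x).sub (hi z)).abs
      ((hρint t ht).abs.const_mul (L1 * ‖x - z‖)) fun y => ?_).trans ?_
    · have h2 := (hH1c0 (y - x) (y - z) t ht).1
      rw [sub_sub_sub_cancel_left, norm_sub_rev] at h2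
      change |c0 (y - x) t * ρ y t - c0 (y - z) t * ρ y t| ≤ L1 * ‖x - z‖ * |ρ y t|
      rw [← sub_mul, abs_mul]
      exact mul_le_mul_of_nonneg_right h2 (abs_nonneg _)
    · rw [integral_const_mul]
      exact mul_le_mul_of_nonneg_left (hP t ht) (by positivity)
  have h2 := (hH1c1 x z t ht).1
  have h3 : convVel c0 c1 ρ x t - convVel c0 c1 ρ z t
      = ((∫ y : Euc N, c0 (y - x) t * ρ y t) - ∫ y : Euc N, c0 (y - z) t * ρ y t)
        + (c1 x t - c1 z t) := by simp only [convVel]; ring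
  rw [h3]
  refine (abs_add_le _ _).trans ?_
  linarith

lemma continuousOn_convVel
    (hc0 : ContinuousOn (fun p : Euc N × ℝ => c0 p.1 p.2)
      ((Set.univ : Set (Euc N)) ×ˢ Set.Icc (0 : ℝ) T))
    (hc1 : ContinuousOn (fun p : Euc N × ℝ => c1 p.1 p.2)
      ((Set.univ : Set (Euc N)) ×ˢ Set.Icc (0 : ℝ) T))
    (hL1 : 0 < L1)
    (hH1c0 : ∀ x y : Euc N, ∀ t ∈ Set.Icc (0 : ℝ) T,
      |c0 x t - c0 y t| ≤ L1 * ‖x - y‖ ∧ |c0 x t| ≤ L1')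
    (hρint : ∀ t ∈ Set.Icc (0 : ℝ) T, Integrable (fun y => ρ y t))
    (hρcont : ∀ t ∈ Set.Icc (0 : ℝ) T,
      Tendsto (fun s => ∫ y : Euc N, |ρ y s - ρ y t|) (𝓝[Set.Icc (0 : ℝ) T] t) (𝓝 0))
    (x : Euc N) : ContinuousOn (convVel c0 c1 ρ x) (Icc 0 T) := by
  have hslice : ∀ c : Euc N → ℝ → ℝ, ContinuousOn (fun p : Euc N × ℝ => c p.1 p.2)
      ((Set.univ : Set (Euc N)) ×ˢ Set.Icc (0 : ℝ) T) → ∀ y, ContinuousOn (c y) (Icc 0 T) :=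
    fun c hc y => hc.comp (g := fun p : Euc N × ℝ => c p.1 p.2) (f := fun t : ℝ => (y, t)) (by fun_prop) fun t ht => ⟨mem_univ _, ht⟩
  suffices hconv : ContinuousOn (fun t => ∫ y : Euc N, c0 (y - x) t * ρ y t) (Icc 0 T) from
    hconv.add (hslice c1 hc1 x)
  intro t ht
  rw [ContinuousWithinAt]
  have hi : ∀ s ∈ Icc 0 T, ∀ f : Euc N → ℝ, Integrable f →
      Integrable (fun y => c0 (y - x) s * f y) :=
    fun s hs f hf => integrable_translate_mul hL1 hH1c0 hf x hs
  have hA : Tendsto (fun s => ∫ y : Euc N, c0 (y - x) s * (ρ y s - ρ y t))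
      (𝓝[Icc 0 T] t) (𝓝 0) := by
    refine squeeze_zero_norm' ?_ (by simpa using (hρcont t ht).const_mul L1')
    filter_upwards [self_mem_nhdsWithin] with s hs
    have hd : Integrable (fun y => ρ y s - ρ y t) := (hρint s hs).sub (hρint t ht)
    rw [← integral_const_mul]
    refine (norm_integral_le_integral_norm _).trans
      (integral_mono (hi s hs _ hd).norm (hd.abs.const_mul L1') fun y => ?_)
    simp only [norm_mul, Real.norm_eq_abs]
    exact mul_le_mul_of_nonneg_right (hH1c0 (y - x) 0 s hs).2 (abs_nonneg _)
  have hB : Tendsto (fun s => ∫ y : Euc N, c0 (y - x) s * ρ y t)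
      (𝓝[Icc 0 T] t) (𝓝 (∫ y : Euc N, c0 (y - x) t * ρ y t)) := by
    refine tendsto_integral_filter_of_dominated_convergence (fun y => L1' * |ρ y t|) ?_ ?_
      ((hρint t ht).abs.const_mul L1') ?_
    · filter_upwards [self_mem_nhdsWithin] with s hs
      exact (hi s hs _ (hρint t ht)).aestronglyMeasurable
    · filter_upwards [self_mem_nhdsWithin] with s hs
      refine Eventually.of_forall fun y => ?_
      rw [norm_mul, Real.norm_eq_abs, Real.norm_eq_abs]
      exact mul_le_mul_of_nonneg_right (hH1c0 (y - x) 0 s hs).2 (abs_nonneg _)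
    · exact Eventually.of_forall fun y => (hslice c0 hc0 (y - x) t ht).mul_const _
  have hAB := hA.add hB
  rw [zero_add] at hAB
  refine hAB.congr' ?_
  filter_upwards [self_mem_nhdsWithin] with s hs
  have hd : Integrable (fun y => ρ y s - ρ y t) := (hρint s hs).sub (hρint t ht)
  rw [← integral_add (hi s hs _ hd) (hi s hs _ (hρint t ht))]
  refine integral_congr_ae (Eventually.of_forall fun y => ?_)
  simp only
  ring

lemma convVel_nonneg (hT : 0 < T) (hL1 : 0 < L1)
    (hH1c0 : ∀ x y : Euc N, ∀ t ∈ Set.Icc (0 : ℝ) T,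
      |c0 x t - c0 y t| ≤ L1 * ‖x - y‖ ∧ |c0 x t| ≤ L1')
    (hc0L1 : ∀ t ∈ Set.Icc (0 : ℝ) T, Integrable (fun y => c0 y t))
    (hH5 : ∀ x : Euc N, ∀ t ∈ Set.Icc (0 : ℝ) T, (∫ y : Euc N, |c0 y t|) ≤ c1 x t)
    (hρmeas : Measurable (fun p : Euc N × ℝ => ρ p.1 p.2))
    (hρbd : ∀ᵐ p : Euc N × ℝ ∂volume, p.2 ∈ Set.Icc (0 : ℝ) T → 0 ≤ ρ p.1 p.2 ∧ ρ p.1 p.2 ≤ 1)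
    (hρint : ∀ t ∈ Set.Icc (0 : ℝ) T, Integrable (fun y => ρ y t))
    {x : Euc N} (hcont : ContinuousOn (convVel c0 c1 ρ x) (Icc 0 T))
    {t : ℝ} (ht : t ∈ Icc 0 T) : 0 ≤ convVel c0 c1 ρ x t := by
  have hms : MeasurableSet {p : Euc N × ℝ | p.2 ∈ Set.Icc (0 : ℝ) T →
      0 ≤ ρ p.1 p.2 ∧ ρ p.1 p.2 ≤ 1} := by
    have h1 : MeasurableSet {p : Euc N × ℝ | p.2 ∈ Set.Icc (0 : ℝ) T} :=
      measurable_snd measurableSet_Icc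
    have h2 : MeasurableSet {p : Euc N × ℝ | 0 ≤ ρ p.1 p.2 ∧ ρ p.1 p.2 ≤ 1} :=
      (measurableSet_le measurable_const hρmeas).inter (measurableSet_le hρmeas measurable_const)
    have h3 := h1.compl.union h2
    convert h3 using 1
    ext p
    simp only [mem_ofPred_eq, mem_union, mem_compl_iff]
    tauto
  rw [Measure.volume_eq_prod] at hρbd
  have hae : ∀ᵐ s : ℝ, ∀ᵐ y : Euc N, s ∈ Icc 0 T → 0 ≤ ρ y s ∧ ρ y s ≤ 1 :=
    (Measure.ae_ae_comm (p := fun (y : Euc N) (s : ℝ) =>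
      s ∈ Icc 0 T → 0 ≤ ρ y s ∧ ρ y s ≤ 1) hms).1 (Measure.ae_ae_of_ae_prod hρbd)
  have hnn : ∀ s ∈ Ioo 0 T ∩ {s | ∀ᵐ y : Euc N, s ∈ Icc 0 T → 0 ≤ ρ y s ∧ ρ y s ≤ 1},
      0 ≤ convVel c0 c1 ρ x s := by
    rintro s ⟨hs, hys⟩
    have hsI := Ioo_subset_Icc_self hs
    have h1 : |∫ y : Euc N, c0 (y - x) s * ρ y s| ≤ ∫ y : Euc N, |c0 y s| := by
      rw [← integral_sub_right_eq_self (fun y : Euc N => |c0 y s|) x]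
      refine abs_integral_le_integral_abs.trans (integral_mono_ae
        (integrable_translate_mul hL1 hH1c0 (hρint s hsI) x hsI).abs
        ((hc0L1 s hsI).abs.comp_sub_right x) ?_)
      filter_upwards [hys] with y hy
      obtain ⟨h2, h3⟩ := hy hsI
      rw [abs_mul, abs_of_nonneg h2]
      exact mul_le_of_le_one_right (abs_nonneg _) h3
    have h2 := hH5 x s hsI
    have h3 := neg_abs_le (∫ y : Euc N, c0 (y - x) s * ρ y s)
    rw [convVel]
    linarith
  have hcl : Icc 0 T ⊆ closure (Ioo 0 T ∩
      {s | ∀ᵐ y : Euc N, s ∈ Icc 0 T → 0 ≤ ρ y s ∧ ρ y s ≤ 1}) := by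
    exact (closure_Ioo hT.ne).symm.subset.trans (closure_minimal
      ((Measure.dense_of_ae hae).open_subset_closure_inter isOpen_Ioo) isClosed_closure)
  have hsub : Ioo 0 T ∩ {s | ∀ᵐ y : Euc N, s ∈ Icc 0 T → 0 ≤ ρ y s ∧ ρ y s ≤ 1} ⊆ Icc 0 T :=
    inter_subset_left.trans Ioo_subset_Icc_self
  exact isClosed_Ici.closure_subset
    (((hcont t ht).mono hsub).mem_closure (hcl ht) hnn)

lemma convVel_le (hL1 : 0 < L1) (hL1' : 0 < L1')
    (hH1c0 : ∀ x y : Euc N, ∀ t ∈ Set.Icc (0 : ℝ) T,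
      |c0 x t - c0 y t| ≤ L1 * ‖x - y‖ ∧ |c0 x t| ≤ L1')
    (hH1c1 : ∀ x y : Euc N, ∀ t ∈ Set.Icc (0 : ℝ) T,
      |c1 x t - c1 y t| ≤ L1 * ‖x - y‖ ∧ |c1 x t| ≤ L1')
    (hρint : ∀ t ∈ Set.Icc (0 : ℝ) T, Integrable (fun y => ρ y t))
    {P : ℝ} (hP : ∀ t ∈ Icc (0 : ℝ) T, ∫ y : Euc N, |ρ y t| ≤ P)
    (x : Euc N) {t : ℝ} (ht : t ∈ Icc 0 T) :
    convVel c0 c1 ρ x t ≤ L1' * P + L1' := by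
  have h1 : ∫ y : Euc N, c0 (y - x) t * ρ y t ≤ L1' * P := by
    refine (integral_mono (integrable_translate_mul hL1 hH1c0 (hρint t ht) x ht)
      ((hρint t ht).abs.const_mul L1') fun y => ?_).trans ?_
    · simp only
      refine (le_abs_self _).trans ?_
      rw [abs_mul]
      exact mul_le_mul_of_nonneg_right (hH1c0 (y - x) 0 t ht).2 (abs_nonneg _)
    · rw [integral_const_mul]
      exact mul_le_mul_of_nonneg_left (hP t ht) hL1'.le
  have h2 := le_of_abs_le (hH1c1 x x t ht).2
  rw [convVel]
  linarith

end Velocity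

/-- For a nonnegative velocity the solution is nondecreasing in time. -/
lemma IsViscositySolution.monotoneOn {N : ℕ} {T : ℝ} {c u : Euc N → ℝ → ℝ}
    {u0 : Euc N → ℝ} (hsol : IsViscositySolution N T c u u0)
    (hu : ContinuousOn (fun p : Euc N × ℝ => u p.1 p.2)
      ((Set.univ : Set (Euc N)) ×ˢ Set.Icc (0 : ℝ) T))
    (hc0 : ∀ x : Euc N, ∀ t ∈ Icc (0 : ℝ) T, 0 ≤ c x t) (x : Euc N) :
    MonotoneOn (u x) (Icc 0 T) := by
  intro s hs t ht hst
  rcases hst.eq_or_lt with rfl | hlt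
  · exact le_rfl
  · have := hsol.isSubsolution_neg.le_of_growth (v := fun z τ => -u z τ) hu.neg hs.1 hlt ht.2
      (y := x) (z := x) (r := 1) (γ := fun _ => 0) continuous_const (fun _ => le_rfl)
      (fun w _ τ hτ => hc0 w τ ⟨hs.1.trans hτ.1.le, hτ.2.le.trans ht.2⟩) (by simp) (by simp)
    linarith

/-- A bounded initial positivity set stays in a fixed ball. -/
lemma IsViscositySolution.exists_superlevel_subset {N : ℕ} {T : ℝ} (hT : 0 < T)
    {c u : Euc N → ℝ → ℝ} {u0 : Euc N → ℝ} (hsol : IsViscositySolution N T c u u0)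
    (hu : ContinuousOn (fun p : Euc N × ℝ => u p.1 p.2)
      ((Set.univ : Set (Euc N)) ×ˢ Set.Icc (0 : ℝ) T))
    {M : ℝ} (hM : 0 ≤ M) (hcM : ∀ x : Euc N, ∀ t ∈ Icc (0 : ℝ) T, c x t ≤ M)
    (hcpt : IsCompact {x : Euc N | 0 ≤ u0 x}) :
    ∃ R : ℝ, ∀ t ∈ Icc (0 : ℝ) T, {x : Euc N | 0 ≤ u x t} ⊆ closedBall 0 R := by
  obtain ⟨R, hR⟩ := hcpt.isBounded.subset_closedBall 0
  have hr : 0 < M * T + 1 := by positivity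
  refine ⟨R + (M * T + 1), fun t ht x hx => ?_⟩
  by_contra hxR
  have hus : Continuous fun z => u z 0 :=
    continuousOn_univ.1 (hu.comp (f := fun z : Euc N => (z, (0 : ℝ))) (by fun_prop)
      fun z _ => ⟨mem_univ _, left_mem_Icc.2 hT.le⟩)
  obtain ⟨y, hy, hmax⟩ := (isCompact_closedBall x (M * T + 1)).exists_isMaxOn
    ⟨x, mem_closedBall_self hr.le⟩ hus.continuousOn
  have hxy : u x t ≤ u y 0 := by
    rcases ht.1.eq_or_lt with rfl | hpos
    · exact hmax (mem_closedBall_self hr.le)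
    · refine hsol.isSubsolution.le_of_le_closedBall hu le_rfl hpos ht.2 (γ := fun _ => M)
        continuous_const (fun _ => hM)
        (fun z _ τ hτ => hcM z τ ⟨hτ.1.le, hτ.2.le.trans ht.2⟩) ?_ hmax
      rw [intervalIntegral.integral_const, smul_eq_mul, sub_zero]
      nlinarith [ht.2]
  have hyR : y ∈ closedBall 0 R := by
    refine hR (show 0 ≤ u0 y from ?_)
    rw [← hsol.1 y]
    exact le_trans hx hxy
  refine hxR ?_
  rw [mem_closedBall] at *
  have := dist_triangle x y 0
  rw [dist_comm x y] at this
  linarith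

/-- Continuity in time of the positivity set when the points reached exactly at any
given positive time form a null set. -/
lemma IsViscositySolution.tendsto_volume_symmDiff {N : ℕ} {T : ℝ} (hT : 0 < T)
    {c u : Euc N → ℝ → ℝ} {u0 : Euc N → ℝ} (hsol : IsViscositySolution N T c u u0)
    (hu : ContinuousOn (fun p : Euc N × ℝ => u p.1 p.2)
      ((Set.univ : Set (Euc N)) ×ˢ Set.Icc (0 : ℝ) T))
    {L M : ℝ} (hL : 0 < L) (hM : 0 ≤ M)
    (hcL : ∀ x y : Euc N, ∀ t ∈ Icc (0 : ℝ) T, |c x t - c y t| ≤ L * ‖x - y‖)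
    (hc0 : ∀ x : Euc N, ∀ t ∈ Icc (0 : ℝ) T, 0 ≤ c x t)
    (hcM : ∀ x : Euc N, ∀ t ∈ Icc (0 : ℝ) T, c x t ≤ M)
    (hcc : ∀ x : Euc N, ContinuousOn (c x) (Icc 0 T))
    (hcpt : IsCompact {x : Euc N | 0 ≤ u0 x}) {t : ℝ} (ht : t ∈ Icc 0 T) :
    Tendsto (fun s => volume ({x : Euc N | 0 ≤ u x s} ∆ {x : Euc N | 0 ≤ u x t}))
        (𝓝[Set.Icc (0 : ℝ) T] t) (𝓝 0) := by
  have hmono := hsol.monotoneOn hu hc0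
  obtain ⟨R, hR⟩ := hsol.exists_superlevel_subset hT hu hM hcM hcpt
  have hmeas : ∀ s ∈ Icc 0 T, MeasurableSet {x : Euc N | 0 ≤ u x s} := fun s hs => by
    have hus : Continuous fun z => u z s :=
      continuousOn_univ.1 (hu.comp (f := fun z : Euc N => (z, s)) (by fun_prop)
        fun z _ => ⟨mem_univ _, hs⟩)
    exact (isClosed_le continuous_const hus).measurableSet
  have hnull : ∀ᵐ x : Euc N, 0 < t → 0 ≤ u x t → ∃ s ∈ Ico 0 t, 0 ≤ u x s := by
    rcases ht.1.eq_or_lt with h | h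
    · exact Eventually.of_forall fun x hx => absurd hx (by rw [h]; exact lt_irrefl _)
    · refine measure_mono_null (fun x hx => ?_)
        (volume_arrival_eq_zero hT hsol hu hL hcL hc0 hcc h ht.2)
      simp only [mem_compl_iff, mem_ofPred_eq] at hx
      push Not at hx
      exact ⟨hx.2.1, hx.2.2⟩
  -- extend the family by `∅` outside `[0, T]`, so that every member is measurable
  classical
  set A : ℝ → Set (Euc N) := fun s =>
    if s ∈ Icc 0 T then {x : Euc N | 0 ≤ u x s} ∆ {x : Euc N | 0 ≤ u x t} else ∅
  have hAeq : ∀ s ∈ Icc 0 T, A s = {x : Euc N | 0 ≤ u x s} ∆ {x : Euc N | 0 ≤ u x t} :=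
    fun s hs => if_pos hs
  have hlim : Tendsto (fun s => volume (A s)) (𝓝[Icc 0 T] t)
      (𝓝 (volume (∅ : Set (Euc N)))) := by
    refine tendsto_measure_of_ae_tendsto_indicator (B := closedBall (0 : Euc N) R) _
      MeasurableSet.empty (fun s => ?_) measurableSet_closedBall
      measure_closedBall_lt_top.ne ?_ ?_
    · by_cases hs : s ∈ Icc 0 T
      · rw [hAeq s hs]
        exact (hmeas s hs).symmDiff (hmeas t ht)
      · rw [show A s = ∅ from if_neg hs]
        exact MeasurableSet.empty
    · filter_upwards [self_mem_nhdsWithin] with s hs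
      rw [hAeq s hs]
      exact (Set.symmDiff_subset_union).trans (union_subset (hR s hs) (hR t ht))
    · filter_upwards [hnull] with x hx
      have hux : ContinuousWithinAt (u x) (Icc 0 T) t :=
        hu.comp (f := fun τ : ℝ => (x, τ)) (by fun_prop) (fun τ hτ => ⟨mem_univ _, hτ⟩) t ht
      suffices h : ∀ᶠ s in 𝓝[Icc 0 T] t, (0 ≤ u x s ↔ 0 ≤ u x t) by
        filter_upwards [h, self_mem_nhdsWithin] with s hs hsI
        rw [hAeq s hsI, Set.mem_symmDiff]
        simp only [mem_ofPred_eq, mem_empty_iff_false, iff_false]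
        tauto
      rcases lt_or_ge (u x t) 0 with hneg | hpos
      · filter_upwards [hux.eventually_lt_const hneg] with s hs
        exact ⟨fun h => absurd h (not_le.2 hs), fun h => absurd h (not_le.2 hneg)⟩
      · rcases ht.1.eq_or_lt with h0 | h0
        · filter_upwards [self_mem_nhdsWithin] with s hs
          exact ⟨fun _ => hpos, fun _ => hpos.trans (hmono x ht hs (h0 ▸ hs.1))⟩
        · obtain ⟨s0, hs0, hus0⟩ := hx h0 hpos
          filter_upwards [self_mem_nhdsWithin,
            mem_nhdsWithin_of_mem_nhds (Ioi_mem_nhds hs0.2)] with s hs hs0s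
          exact ⟨fun _ => hpos, fun _ => hus0.trans
            (hmono x ⟨hs0.1, hs0.2.le.trans ht.2⟩ hs (le_of_lt hs0s))⟩
  rw [measure_empty] at hlim
  refine hlim.congr' ?_
  filter_upwards [self_mem_nhdsWithin] with s hs
  rw [hAeq s hs]

/-- L¹-continuity in time of the indicator function of the positivity set of
the solution with velocity c[ρ]. -/
theorem stmt13 (N : ℕ) (hN : 1 ≤ N) (T : ℝ) (hT : 0 < T)
    (c0 c1 : Euc N → ℝ → ℝ)
    (hc0 : ContinuousOn (fun p : Euc N × ℝ => c0 p.1 p.2)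
      ((Set.univ : Set (Euc N)) ×ˢ Set.Icc (0 : ℝ) T))
    (hc1 : ContinuousOn (fun p : Euc N × ℝ => c1 p.1 p.2)
      ((Set.univ : Set (Euc N)) ×ˢ Set.Icc (0 : ℝ) T))
    (L1 L1' : ℝ) (hL1 : 0 < L1) (hL1' : 0 < L1')
    (hH1c0 : ∀ x y : Euc N, ∀ t ∈ Set.Icc (0 : ℝ) T,
      |c0 x t - c0 y t| ≤ L1 * ‖x - y‖ ∧ |c0 x t| ≤ L1')
    (hH1c1 : ∀ x y : Euc N, ∀ t ∈ Set.Icc (0 : ℝ) T,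
      |c1 x t - c1 y t| ≤ L1 * ‖x - y‖ ∧ |c1 x t| ≤ L1')
    -- (H5)
    (hc0L1 : ∀ t ∈ Set.Icc (0 : ℝ) T, Integrable (fun y => c0 y t))
    (hc0L1cont : ∀ t ∈ Set.Icc (0 : ℝ) T,
      Tendsto (fun s => ∫ y : Euc N, |c0 y s - c0 y t|) (𝓝[Set.Icc (0 : ℝ) T] t) (𝓝 0))
    (hH5 : ∀ x : Euc N, ∀ t ∈ Set.Icc (0 : ℝ) T, (∫ y : Euc N, |c0 y t|) ≤ c1 x t)
    -- assumptions on ρ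
    (ρ : Euc N → ℝ → ℝ) (hρmeas : Measurable (fun p : Euc N × ℝ => ρ p.1 p.2))
    (hρbd : ∀ᵐ p : Euc N × ℝ ∂volume, p.2 ∈ Set.Icc (0 : ℝ) T → 0 ≤ ρ p.1 p.2 ∧ ρ p.1 p.2 ≤ 1)
    (hρint : ∀ t ∈ Set.Icc (0 : ℝ) T, Integrable (fun y => ρ y t))
    (hρcont : ∀ t ∈ Set.Icc (0 : ℝ) T,
      Tendsto (fun s => ∫ y : Euc N, |ρ y s - ρ y t|) (𝓝[Set.Icc (0 : ℝ) T] t) (𝓝 0))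
    -- assumptions on u0 and u
    (u0 : Euc N → ℝ) (K : ℝ≥0) (hu0 : LipschitzWith K u0)
    (η0 : ℝ) (hη0 : 0 < η0)
    (hH3 : ∀ x : Euc N, ∀ p ∈ SuperDiff u0 x, η0 ≤ |u0 x| + ‖p‖)
    (hcpt : IsCompact {x : Euc N | 0 ≤ u0 x})
    (u : Euc N → ℝ → ℝ)
    (huc : ContinuousOn (fun p : Euc N × ℝ => u p.1 p.2)
      ((Set.univ : Set (Euc N)) ×ˢ Set.Icc (0 : ℝ) T))
    (husol : IsViscositySolution N T (convVel c0 c1 ρ) u u0) :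
    ∀ t ∈ Set.Icc (0 : ℝ) T,
      Tendsto (fun s => volume ({x : Euc N | 0 ≤ u x s} ∆ {x : Euc N | 0 ≤ u x t}))
        (𝓝[Set.Icc (0 : ℝ) T] t) (𝓝 0) := by
  obtain ⟨P, hP0, hP⟩ := exists_integral_abs_le hT hρint hρcont
  have hcc := continuousOn_convVel hc0 hc1 hL1 hH1c0 hρint hρcont
  intro t ht
  exact husol.tendsto_volume_symmDiff hT huc (L := L1 * (P + 1)) (M := L1' * P + L1')
    (by positivity) (by positivity)
    (fun x y s hs => abs_convVel_sub_le hL1 hH1c0 hH1c1 hρint hP x y hs)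
    (fun x s hs => convVel_nonneg hT hL1 hH1c0 hc0L1 hH5 hρmeas hρbd hρint (hcc x) hs)
    (fun x s hs => convVel_le hL1 hL1' hH1c0 hH1c1 hρint hP x hs) hcc hcpt ht
end
end

section
/- Let N ≥ 1, T > 0, let c : ℝ^N × [0,T] → ℝ be continuous satisfying (H1), (H2), (H4) with constants L1, L1', L2, and let u0 : ℝ^N → ℝ be Lipschitz continuous, semiconvex with constant C0, satisfying (H3) with constant η0 > 0, and such that {x : u0(x) ≥ 0} is compact. Let u be the Lipschitz continuous viscosity solution of u_t = c(x,t)|Du| with initial datum u0, let γ, η > 0 be constants such that −|u(x,t)| − (e^{γt}/4)|Du(x,t)|² + η ≤ 0 at almost every (x,t) ∈ ℝ^N × (0,T), let L4 = L4(L1,L1',L2,C0,η0,T) be the constant of the a priori level-set measure estimate ℒ^N({a ≤ u(·,t) ≤ b}) ≤ e^{L4 t} ℒ^N({a ≤ u0 ≤ b}), and set η̄ = min{η/2, η0/2, η0²/(4C0)}. Then for all a, b with −η̄ < a < b < η̄, the perimeter per({u0 ≥ b}) = H^{N−1}(∂{x : u0(x) ≥ b}) is finite, and for all t ∈ [0,T]: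 ℒ^N({x : a ≤ u(x,t) ≤ b}) ≤ (3^N e^{L4 t}(b − a)/η0) · per({u0 ≥ b}). -/
open Set MeasureTheory Filter Metric
open scoped Topology ENNReal NNReal RealInnerProductSpace symmDiff

noncomputable section

theorem hausdorffMeasure_le_mul_image {X Y : Type*} [MetricSpace X] [MetricSpace Y]
    [MeasurableSpace X] [BorelSpace X] [MeasurableSpace Y] [BorelSpace Y] {f : X → Y} {s : Set X}
    {K : ℝ≥0} (h : ∀ x ∈ s, ∀ y ∈ s, dist x y ≤ K * dist (f x) (f y)) {d : ℝ} (hd : 0 ≤ d) :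
    μH[d] s ≤ (K : ℝ≥0∞) ^ d * μH[d] (f '' s) := by
  have ha : AntilipschitzWith K (s.domRestrict f) :=
    AntilipschitzWith.of_le_mul_dist fun x y => h x x.2 y y.2
  have h1 := ha.le_hausdorffMeasure_image hd univ
  have h2 : μH[d] (Subtype.val '' (univ : Set s)) = μH[d] (univ : Set s) :=
    isometry_subtype_coe.hausdorffMeasure_image (Or.inl hd) _
  rw [image_univ, Subtype.range_coe] at h2
  rw [h2]
  rwa [image_univ, range_domRestrict] at h1

theorem exists_isometry_apply_zero_eq_inner {n : ℕ} {ν : Euc (n + 1)} (hν : ‖ν‖ = 1) :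
    ∃ R : Euc (n + 1) ≃ₗᵢ[ℝ] Euc (n + 1), ∀ y, R y 0 = ⟪ν, y⟫ := by
  have hv : Orthonormal ℝ (({0} : Set (Fin (n + 1))).domRestrict fun _ => ν) := by
    refine ⟨fun _ => hν, fun i j hij => ?_⟩
    exact absurd (Subtype.ext (i.2.trans j.2.symm)) hij
  obtain ⟨b, hb⟩ := hv.exists_orthonormalBasis_extension_of_card_eq (by simp)
  refine ⟨b.repr, fun y => ?_⟩
  rw [b.repr_apply_apply, hb 0 rfl]

/-- Separation of the first coordinate of Euclidean space. -/
def splitFirst {n : ℕ} (w : Euc (n + 1)) : ℝ × (Fin n → ℝ) := (w 0, fun i => w i.succ)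

theorem measurePreserving_splitFirst (n : ℕ) :
    MeasurePreserving (splitFirst (n := n)) volume volume := by
  have h1 := PiLp.volume_preserving_ofLp (Fin (n + 1))
  have h2 := volume_preserving_piFinSuccAbove (fun _ : Fin (n + 1) => ℝ) 0
  exact h2.comp h1

theorem injective_splitFirst (n : ℕ) : Function.Injective (splitFirst (n := n)) := by
  intro x y h
  ext i
  refine Fin.cases ?_ (fun j => ?_) i
  · exact congrArg Prod.fst h
  · exact congrFun (congrArg Prod.snd h) j

theorem continuous_splitFirst (n : ℕ) : Continuous (splitFirst (n := n)) := by
  unfold splitFirst; fun_prop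

theorem dist_splitFirst_snd_le {n : ℕ} (x y : Euc (n + 1)) :
    dist (splitFirst x).2 (splitFirst y).2 ≤ dist x y := by
  rw [dist_pi_le_iff dist_nonneg]
  intro i
  have := PiLp.norm_apply_le (x - y) i.succ
  simpa [splitFirst, dist_eq_norm] using this

theorem dist_le_of_splitFirst {n : ℕ} (x y : Euc (n + 1))
    (h : |(x - y) 0| ≤ 1 / 2 * ‖x - y‖) :
    dist x y ≤ (2 * n : ℝ≥0) * dist (splitFirst x).2 (splitFirst y).2 := by
  set t := dist (splitFirst x).2 (splitFirst y).2 with ht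
  have ht0 : 0 ≤ t := dist_nonneg
  have hi : ∀ i : Fin n, |(x - y) i.succ| ≤ t := fun i =>
    dist_le_pi_dist (splitFirst x).2 (splitFirst y).2 i
  have hsq : ‖x - y‖ ^ 2 ≤ (1 / 2 * ‖x - y‖) ^ 2 + n * t ^ 2 := by
    have key : ‖x - y‖ ^ 2 = ‖(x - y) 0‖ ^ 2 + ∑ i : Fin n, ‖(x - y) i.succ‖ ^ 2 := by
      rw [EuclideanSpace.norm_sq_eq, Fin.sum_univ_succ]
    have h0 : ‖(x - y) 0‖ ^ 2 ≤ (1 / 2 * ‖x - y‖) ^ 2 :=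
      pow_le_pow_left₀ (norm_nonneg _) h 2
    have h1 : ∑ i : Fin n, ‖(x - y) i.succ‖ ^ 2 ≤ ∑ _i : Fin n, t ^ 2 :=
      Finset.sum_le_sum fun i _ => pow_le_pow_left₀ (norm_nonneg _) (hi i) 2
    simp only [Finset.sum_const, Finset.card_univ, Fintype.card_fin, nsmul_eq_mul] at h1
    linarith
  have hn : (n : ℝ) ≤ n ^ 2 := by
    exact_mod_cast Nat.le_self_pow (by norm_num) n
  rw [dist_eq_norm]
  push_cast
  refine abs_le_of_sq_le_sq' ?_ (by positivity) |>.2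
  nlinarith [mul_le_mul_of_nonneg_right hn (sq_nonneg t), sq_nonneg ‖x - y‖]

/-- Measure of the image of a set under the near-identity map `y ↦ y + (g y - ⟪ν, y⟫) ν`,
sliced along the level sets of `g`. -/
theorem volume_image_level_le {n : ℕ} {ν : Euc (n + 1)} (hν : ‖ν‖ = 1) {g : Euc (n + 1) → ℝ}
    (hg : Continuous g) {D : Set (Euc (n + 1))} (hD : MeasurableSet D)
    (hinj : InjOn (fun y => y + (g y - ⟪ν, y⟫) • ν) D) :
    ∃ φ : ℝ → ℝ≥0∞, Measurable φ ∧ (∀ s, φ s ≤ μH[(n : ℝ)] (D ∩ g ⁻¹' {s})) ∧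
      volume ((fun y => y + (g y - ⟪ν, y⟫) • ν) '' D) = ∫⁻ s, φ s := by
  obtain ⟨R, hR⟩ := exists_isometry_apply_zero_eq_inner hν
  set f : Euc (n + 1) → Euc (n + 1) := fun y => y + (g y - ⟪ν, y⟫) • ν with hf
  have hfc : Continuous f := by fun_prop
  have hνν : ⟪ν, ν⟫ = (1 : ℝ) := by rw [real_inner_self_eq_norm_sq, hν]; norm_num
  have hfD : MeasurableSet (f '' D) := hD.image_of_continuousOn_injOn hfc.continuousOn hinj
  have hmp : MeasurePreserving (fun w => splitFirst (R w)) (volume : Measure (Euc (n + 1))) volume :=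
    (measurePreserving_splitFirst n).comp R.measurePreserving
  have hc : Continuous (fun w => splitFirst (R w)) := (continuous_splitFirst n).comp R.continuous
  have hi : Function.Injective (fun w => splitFirst (R w)) :=
    (injective_splitFirst n).comp R.injective
  set G := (fun w => splitFirst (R w)) '' (f '' D) with hG
  have hGm : MeasurableSet G := hfD.image_of_continuousOn_injOn hc.continuousOn hi.injOn
  have hvol : volume (f '' D) = volume G := by
    rw [← hmp.measure_preimage hGm.nullMeasurableSet, hG, preimage_image_eq _ hi]
  have hfst : ∀ y, (splitFirst (R (f y))).1 = g y := by
    intro y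
    change R (f y) 0 = g y
    rw [hR, hf]
    simp only [inner_add_right, inner_smul_right, hνν]
    ring
  have hRν : ∀ i : Fin n, R ν i.succ = 0 := by
    have h1 : ‖R ν‖ ^ 2 = 1 := by rw [R.norm_map, hν]; norm_num
    rw [EuclideanSpace.norm_sq_eq, Fin.sum_univ_succ, hR, hνν] at h1
    have h2 : ∑ i : Fin n, ‖R ν i.succ‖ ^ 2 = 0 := by
      norm_num at h1 ⊢; exact h1
    intro i
    have := (Finset.sum_eq_zero_iff_of_nonneg (fun i _ => sq_nonneg _)).1 h2 i (Finset.mem_univ i)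
    simpa using this
  have hsnd : ∀ y, (splitFirst (R (f y))).2 = (splitFirst (R y)).2 := by
    intro y
    funext i
    simp [splitFirst, hf, hRν]
  refine ⟨fun s => volume (Prod.mk s ⁻¹' G), measurable_measure_prodMk_left hGm, fun s => ?_, ?_⟩
  · have hsub : Prod.mk s ⁻¹' G ⊆ (fun y => (splitFirst (R y)).2) '' (D ∩ g ⁻¹' {s}) := by
      rintro z ⟨_, ⟨y, hy, rfl⟩, hyz⟩
      have h1 : (splitFirst (R (f y))).1 = s := congrArg Prod.fst hyz
      have h2 : (splitFirst (R (f y))).2 = z := congrArg Prod.snd hyz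
      exact ⟨y, ⟨hy, (hfst y).symm.trans h1⟩, (hsnd y).symm.trans h2⟩
    have hlip : LipschitzWith 1 (fun y => (splitFirst (R y)).2) :=
      LipschitzWith.of_dist_le_mul fun x y => by
        simpa using dist_splitFirst_snd_le (R x) (R y)
    calc volume (Prod.mk s ⁻¹' G)
        ≤ volume ((fun y => (splitFirst (R y)).2) '' (D ∩ g ⁻¹' {s})) := measure_mono hsub
      _ = μH[(n : ℝ)] ((fun y => (splitFirst (R y)).2) '' (D ∩ g ⁻¹' {s})) := by
        rw [← hausdorffMeasure_pi_real, Fintype.card_fin]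
      _ ≤ _ := by
        simpa using hlip.hausdorffMeasure_image_le n.cast_nonneg (D ∩ g ⁻¹' {s})
  · rw [hvol, Measure.volume_eq_prod, Measure.prod_apply hGm]

/-- A coarea inequality for functions with unit gradient. -/
theorem volume_le_of_level_le {n : ℕ} {g : Euc (n + 1) → ℝ} (hg : Continuous g)
    {S : Set (Euc (n + 1))} (hS : MeasurableSet S)
    (hd : ∀ y ∈ S, DifferentiableAt ℝ g y ∧ ‖gradient g y‖ = 1)
    {h : ℝ} (hrange : ∀ y ∈ S, g y ∈ Ioc 0 h) {M : ℝ≥0∞}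
    (hM : ∀ s ∈ Ioc 0 h, μH[(n : ℝ)] (g ⁻¹' {s}) ≤ M) :
    ((2 / 3 : ℝ≥0) : ℝ≥0∞) * volume S ≤ ENNReal.ofReal h * M := by
  have hev := mul_le_addHaar_image_of_lt_det (volume : Measure (Euc (n + 1)))
    (ContinuousLinearMap.id ℝ (Euc (n + 1))) (m := 2 / 3) (by
      simp [ContinuousLinearMap.det]
      rw [← ENNReal.coe_ofNat, ← ENNReal.coe_ofNat, ← ENNReal.coe_div (by norm_num), ← ENNReal.coe_one, ENNReal.coe_lt_coe]
      rw [div_lt_one (by norm_num)]; norm_num)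
  obtain ⟨ε, hε, hε1, hε0⟩ := (hev.and ((Ioo_mem_nhdsGT (zero_lt_one (α := ℝ≥0))))).exists
  obtain ⟨t, A, htd, htm, hcov, happ, hA⟩ := exists_partition_approximatesLinearOn_of_hasFDerivWithinAt
    g S (fderiv ℝ g) (fun x hx => (hd x hx).1.hasFDerivAt.hasFDerivWithinAt) (fun _ => ε)
    (fun _ => hε1.ne')
  rcases S.eq_empty_or_nonempty with rfl | hne
  · simp
  have hν : ∀ k, ∃ ν : Euc (n + 1), ‖ν‖ = 1 ∧ ∀ z, A k z = ⟪ν, z⟫ := by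
    intro k
    obtain ⟨y, hy, hAy⟩ := hA hne k
    refine ⟨gradient g y, (hd y hy).2, fun z => ?_⟩
    rw [hAy, gradient, InnerProductSpace.toDual_symm_apply]
  choose ν hν1 hνA using hν
  have happ' : ∀ k, ApproximatesLinearOn (fun y => y + (g y - ⟪ν k, y⟫) • ν k)
      (ContinuousLinearMap.id ℝ (Euc (n + 1))) (S ∩ t k) ε := by
    intro k x hx y hy
    have h1 := happ k x hx y hy
    rw [hνA, inner_sub_right] at h1
    have : x + (g x - ⟪ν k, x⟫) • ν k - (y + (g y - ⟪ν k, y⟫) • ν k)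
        - ContinuousLinearMap.id ℝ (Euc (n + 1)) (x - y)
        = (g x - g y - (⟪ν k, x⟫ - ⟪ν k, y⟫)) • ν k := by
      simp only [ContinuousLinearMap.id_apply]; module
    rw [this, norm_smul, hν1, mul_one]
    exact h1
  have hinj : ∀ k, InjOn (fun y => y + (g y - ⟪ν k, y⟫) • ν k) (S ∩ t k) := by
    intro k
    have hid : ‖(ContinuousLinearMap.id ℝ (Euc (n + 1)))‖₊ = 1 := ContinuousLinearMap.nnnorm_id
    exact ApproximatesLinearOn.injOn (f' := ContinuousLinearEquiv.refl ℝ (Euc (n + 1))) (happ' k)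
      (Or.inr (by simpa [hid] using hε0))
  choose φ hφm hφle hφ using fun k =>
    volume_image_level_le (hν1 k) hg (hS.inter (htm k)) (hinj k)
  have hSU : S = ⋃ k, S ∩ t k := by rw [← inter_iUnion, inter_eq_left.2 hcov]
  have hdisj : Pairwise (Function.onFun Disjoint fun k => S ∩ t k) := fun i j hij =>
    (htd hij).mono inter_subset_right inter_subset_right
  have hsum : ∀ s, ∑' k, φ k s ≤ (Ioc 0 h).indicator (fun _ => M) s := by
    intro s
    have h1 : ∑' k, φ k s ≤ μH[(n : ℝ)] (S ∩ g ⁻¹' {s}) := by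
      calc ∑' k, φ k s ≤ ∑' k, μH[(n : ℝ)] ((S ∩ t k) ∩ g ⁻¹' {s}) :=
            ENNReal.tsum_le_tsum fun k => hφle k s
        _ = μH[(n : ℝ)] (⋃ k, (S ∩ t k) ∩ g ⁻¹' {s}) := by
            rw [measure_iUnion (fun i j hij => (hdisj hij).mono inter_subset_left inter_subset_left)]
            exact fun k => (hS.inter (htm k)).inter (hg.measurable (measurableSet_singleton s))
        _ = μH[(n : ℝ)] (S ∩ g ⁻¹' {s}) := by rw [← iUnion_inter, ← hSU]
    refine h1.trans ?_
    by_cases hs : s ∈ Ioc 0 h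
    · rw [indicator_of_mem hs]
      exact (measure_mono inter_subset_right).trans (hM s hs)
    · have : S ∩ g ⁻¹' {s} = ∅ := by
        ext y
        simp only [mem_inter_iff, mem_preimage, mem_singleton_iff, mem_empty_iff_false, iff_false]
        rintro ⟨hy, rfl⟩
        exact hs (hrange y hy)
      simp [this]
  calc ((2 / 3 : ℝ≥0) : ℝ≥0∞) * volume S
      = ∑' k, ((2 / 3 : ℝ≥0) : ℝ≥0∞) * volume (S ∩ t k) := by
        rw [ENNReal.tsum_mul_left]
        congr 1
        conv_lhs => rw [hSU]
        exact measure_iUnion hdisj fun k => hS.inter (htm k)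
    _ ≤ ∑' k, ∫⁻ s, φ k s := by
        refine ENNReal.tsum_le_tsum fun k => ?_
        rw [← hφ k]
        exact hε _ _ (happ' k)
    _ = ∫⁻ s, ∑' k, φ k s := (lintegral_tsum fun k => (hφm k).aemeasurable).symm
    _ ≤ ∫⁻ s, (Ioc 0 h).indicator (fun _ => M) s := lintegral_mono hsum
    _ = ENNReal.ofReal h * M := by
        rw [lintegral_indicator_const measurableSet_Ioc, Real.volume_Ioc, sub_zero, mul_comm]

theorem norm_gradient_infDist_eq_one {N : ℕ} {E : Set (Euc N)} (hE : IsClosed E)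
    (hne : E.Nonempty) {y : Euc N} (hy : y ∉ E) (hd : DifferentiableAt ℝ (fun z => infDist z E) y) :
    ‖gradient (fun z => infDist z E) y‖ = 1 := by
  have hnorm : ‖gradient (fun z => infDist z E) y‖ = ‖fderiv ℝ (fun z => infDist z E) y‖ := by
    rw [gradient, LinearIsometryEquiv.norm_map]
  rw [hnorm]
  refine le_antisymm ?_ ?_
  · simpa using norm_fderiv_le_of_lipschitz ℝ (lipschitz_infDist_pt E) (x₀ := y)
  obtain ⟨x, hx, hxy⟩ := hE.exists_infDist_eq_dist hne y
  have hyx : y - x ≠ 0 := sub_ne_zero.2 fun h => hy (h ▸ hx)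
  have hpos : 0 < ‖y - x‖ := norm_pos_iff.2 hyx
  set v := x - y with hv
  have hvn : ‖v‖ = ‖y - x‖ := norm_sub_rev _ _
  have hline : HasDerivAt (fun t : ℝ => infDist (y + t • v) E)
      (fderiv ℝ (fun z => infDist z E) y v) 0 := by
    have h1 : HasFDerivAt (fun z => infDist z E) (fderiv ℝ (fun z => infDist z E) y)
      (y + (0 : ℝ) • v) := by simpa using hd.hasFDerivAt
    have h2 : HasDerivAt (fun t : ℝ => y + t • v) v 0 := by
      simpa using ((hasDerivAt_id (0 : ℝ)).smul_const v).const_add y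
    exact h1.comp_hasDerivAt (0 : ℝ) h2
  have heq : ∀ t ∈ Icc (0 : ℝ) 1, infDist (y + t • v) E = (1 - t) * ‖v‖ := by
    intro t ht
    have hle : infDist (y + t • v) E ≤ (1 - t) * ‖v‖ := by
      refine (infDist_le_dist_of_mem hx).trans_eq ?_
      rw [dist_eq_norm, show y + t • v - x = -((1 - t) • v) by rw [hv]; module, norm_neg,
        norm_smul, Real.norm_of_nonneg (by linarith [ht.2])]
    have hge : infDist y E ≤ infDist (y + t • v) E + dist y (y + t • v) :=
      infDist_le_infDist_add_dist
    rw [hxy, dist_self_add_right, norm_smul, Real.norm_of_nonneg ht.1, dist_eq_norm, ← hvn] at hge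
    linarith
  have hder : HasDerivWithinAt (fun t : ℝ => infDist (y + t • v) E) (-‖v‖) (Icc 0 1) 0 := by
    have h3 : HasDerivAt (fun t : ℝ => (1 - t) * ‖v‖) (-‖v‖) 0 := by
      simpa using ((hasDerivAt_id (0 : ℝ)).const_sub 1).mul_const ‖v‖
    exact h3.hasDerivWithinAt.congr_of_mem heq (by simp)
  have huniq := ((uniqueDiffOn_Icc (zero_lt_one (α := ℝ))) 0 (by simp)).eq_deriv _
    hline.hasDerivWithinAt hder
  have hop := (fderiv ℝ (fun z => infDist z E) y).le_opNorm v
  rw [huniq, norm_neg, norm_norm] at hop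
  rw [← hvn] at hpos
  by_contra hlt
  push Not at hlt
  nlinarith

/-- An interior ball condition at the frontier with a uniform radius. -/
def InteriorBall {N : ℕ} (r : ℝ) (E : Set (Euc N)) : Prop :=
  ∀ x ∈ frontier E, ∃ z, dist x z = r ∧ closedBall z r ⊆ E

theorem le_dist_of_ball_subset {N : ℕ} {E : Set (Euc N)} {y z : Euc N} {r s : ℝ} (hr : 0 ≤ r)
    (hs : 0 < s) (hzE : closedBall z r ⊆ E) (hyE : s ≤ infDist y E) : r + s ≤ dist y z := by
  by_contra! hlt
  have hd : 0 ≤ dist y z := dist_nonneg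
  rcases le_or_gt (dist y z) r with h | h
  · have h1 : y ∈ E := hzE (mem_closedBall.2 h)
    have h2 := infDist_zero_of_mem h1
    linarith
  · have hpos : 0 < dist y z := hr.trans_lt h
    set w := z + (r / dist y z) • (y - z)
    have hw : w ∈ E := hzE (by
      rw [mem_closedBall, dist_eq_norm, add_sub_cancel_left, norm_smul, ← dist_eq_norm,
        Real.norm_of_nonneg (by positivity), div_mul_cancel₀ _ hpos.ne'])
    have h1 := infDist_le_dist_of_mem (x := y) hw
    have h2 : dist y w = dist y z - r := by
      rw [dist_eq_norm, show y - w = (1 - r / dist y z) • (y - z) by simp only [w]; module,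
        norm_smul, Real.norm_of_nonneg (by
          rw [sub_nonneg, div_le_one hpos]; exact h.le), ← dist_eq_norm, sub_mul, div_mul_cancel₀ _ hpos.ne', one_mul]
    linarith

theorem hausdorffMeasure_infDist_level_le {N : ℕ} {E : Set (Euc N)} (hE : IsClosed E)
    (hne : E.Nonempty) {r s : ℝ} (hr : 0 < r) (hs : 0 < s) (hsr : s ≤ 2 * r)
    (hball : InteriorBall r E) {d : ℝ} (hd : 0 ≤ d) :
    μH[d] ((fun z => infDist z E) ⁻¹' {s}) ≤ (3 : ℝ≥0∞) ^ d * μH[d] (frontier E) := by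
  have hproj : ∀ y, ∃ x, x ∈ E ∧ infDist y E = dist y x := fun y =>
    hE.exists_infDist_eq_dist hne y
  choose P hPE hP using hproj
  set A := (fun z => infDist z E) ⁻¹' {s} with hA
  have hPf : ∀ y ∈ A, P y ∈ frontier E := by
    intro y hy
    have hys : infDist y E = s := hy
    rw [frontier, hE.closure_eq]
    refine ⟨hPE y, fun hint => ?_⟩
    obtain ⟨ρ, hρ, hρE⟩ := Metric.isOpen_iff.1 isOpen_interior _ hint
    have h1 : closedBall (P y) (ρ / 2) ⊆ E :=
      (closedBall_subset_ball (by linarith)).trans (hρE.trans interior_subset)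
    have h2 := le_dist_of_ball_subset (by positivity) hs h1 hys.ge
    rw [← hP, hys] at h2
    linarith
  have hz : ∀ y ∈ A, ∃ z, closedBall z r ⊆ E ∧ (r + s) • P y = r • y + s • z ∧
      dist y z = r + s := by
    intro y hy
    have hys : infDist y E = s := hy
    obtain ⟨z, hxz, hzE⟩ := hball _ (hPf y hy)
    have h1 := le_dist_of_ball_subset hr.le hs hzE hys.ge
    have h2 := dist_triangle y (P y) z
    have hyP : dist y (P y) = s := by rw [← hP, hys]
    have h3 : dist y z = r + s := by linarith
    refine ⟨z, hzE, ?_, h3⟩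
    rw [dist_eq_norm] at hyP hxz h3
    have hray : SameRay ℝ (y - P y) (P y - z) := by
      rw [sameRay_iff_norm_add, sub_add_sub_cancel]; linarith
    have := sameRay_iff_norm_smul_eq.1 hray
    rw [hyP, hxz] at this
    rw [smul_sub, smul_sub, sub_eq_sub_iff_add_eq_add] at this
    rw [add_smul, add_comm, this]
  have hexp : ∀ y ∈ A, ∀ y' ∈ A, dist y y' ≤ (3 : ℝ≥0) * dist (P y) (P y') := by
    intro y hy y' hy'
    obtain ⟨z, hzE, hz1, hz2⟩ := hz y hy
    obtain ⟨z', hzE', hz1', hz2'⟩ := hz y' hy'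
    have h1 := le_dist_of_ball_subset hr.le hs hzE' (ge_of_eq hy)
    have h2 := le_dist_of_ball_subset hr.le hs hzE (ge_of_eq hy')
    rw [dist_eq_norm] at hz2 hz2' h1 h2
    have hrs : 0 < r + s := by linarith
    have h1' : ‖y - z‖ ^ 2 ≤ ‖y - z'‖ ^ 2 := by rw [hz2]; gcongr
    have h2' : ‖y' - z'‖ ^ 2 ≤ ‖y' - z‖ ^ 2 := by rw [hz2']; gcongr
    have hin : 0 ≤ ⟪y - y', z - z'⟫ := by
      simp only [norm_sub_sq_real] at h1' h2'
      simp only [inner_sub_left, inner_sub_right]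
      linarith
    have hΔ : (r + s) • (P y - P y') = r • (y - y') + s • (z - z') := by
      rw [smul_sub, hz1, hz1']; module
    have hsq : (r * ‖y - y'‖) ^ 2 ≤ ((r + s) * ‖P y - P y'‖) ^ 2 := by
      have h4 : ((r + s) * ‖P y - P y'‖) ^ 2 = ‖r • (y - y') + s • (z - z')‖ ^ 2 := by
        rw [← hΔ, norm_smul, Real.norm_of_nonneg hrs.le]
      rw [h4, norm_add_sq_real, norm_smul, Real.norm_of_nonneg hr.le, inner_smul_left,
        inner_smul_right]
      have h5 : 0 ≤ r * (s * ⟪y - y', z - z'⟫) := by positivity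
      simp only [conj_trivial]
      nlinarith [sq_nonneg ‖s • (z - z')‖]
    have hle := abs_le_of_sq_le_sq' hsq (by positivity) |>.2
    rw [dist_eq_norm, dist_eq_norm]
    push_cast
    have h6 : (r + s) * ‖P y - P y'‖ ≤ r * (3 * ‖P y - P y'‖) := by
      nlinarith [norm_nonneg (P y - P y')]
    exact le_of_mul_le_mul_left (hle.trans h6) hr
  refine (hausdorffMeasure_le_mul_image hexp hd).trans ?_
  push_cast
  gcongr
  rintro _ ⟨y, hy, rfl⟩
  exact hPf y hy

theorem volume_infDist_shell_le {n : ℕ} {E : Set (Euc (n + 1))} (hE : IsClosed E)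
    (hne : E.Nonempty) {r h : ℝ} (hr : 0 < r) (hhr : h ≤ 2 * r) (hball : InteriorBall r E) :
    volume {y | infDist y E ∈ Ioc 0 h} ≤
      ENNReal.ofReal (3 ^ (n + 1) * h / 2) * μH[(n : ℝ)] (frontier E) := by
  rcases le_or_gt h 0 with h0 | h0
  · rw [Ioc_eq_empty (not_lt.2 h0)]; simp
  set g := fun y : Euc (n + 1) => infDist y E with hg
  have hgc : Continuous g := continuous_infDist_pt E
  have hdiff : ∀ᵐ y : Euc (n + 1), DifferentiableAt ℝ g y :=
    (lipschitz_infDist_pt E).ae_differentiableAt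
  set S := {y | g y ∈ Ioc 0 h} ∩ {y | DifferentiableAt ℝ g y} with hS
  have hSm : MeasurableSet S :=
    (hgc.measurable measurableSet_Ioc).inter (measurableSet_of_differentiableAt ℝ g)
  have hSv : volume {y | g y ∈ Ioc 0 h} ≤ volume S := by
    refine measure_mono_ae ?_
    filter_upwards [hdiff] with y hy hy'
    exact ⟨hy', hy⟩
  have hco := volume_le_of_level_le hgc hSm (h := h)
    (M := 3 ^ (n : ℝ) * μH[(n : ℝ)] (frontier E)) (fun y hy => ⟨hy.2, by
      refine norm_gradient_infDist_eq_one hE hne (fun hyE => ?_) hy.2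
      have h1 : 0 < infDist y E := hy.1.1
      rw [infDist_zero_of_mem hyE] at h1
      exact lt_irrefl _ h1⟩) (fun y hy => hy.1)
    (fun s hs => hausdorffMeasure_infDist_level_le hE hne hr hs.1 (hs.2.trans hhr) hball n.cast_nonneg)
  refine hSv.trans ?_
  have h32 : volume S = ((3 / 2 : ℝ≥0) : ℝ≥0∞) * (((2 / 3 : ℝ≥0) : ℝ≥0∞) * volume S) := by
    rw [← mul_assoc, ← ENNReal.coe_mul]; norm_num
  rw [h32]
  calc _ ≤ ((3 / 2 : ℝ≥0) : ℝ≥0∞) * (ENNReal.ofReal h * (3 ^ (n : ℝ) * μH[(n : ℝ)] (frontier E))) := by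
        gcongr
    _ = _ := by
        rw [show (3 : ℝ) ^ (n + 1) * h / 2 = (3 / 2) * (h * 3 ^ n) by ring,
          ENNReal.ofReal_mul (by norm_num), ENNReal.ofReal_mul h0.le,
          ENNReal.ofReal_pow (by norm_num), ENNReal.rpow_natCast]
        have : ENNReal.ofReal (3 / 2) = ((3 / 2 : ℝ≥0) : ℝ≥0∞) := by
          rw [ENNReal.ofReal]; congr 1; ext; norm_num
        rw [this, ENNReal.ofReal_ofNat]
        ring

theorem hausdorffMeasure_ne_top_of_almost_flat {n : ℕ} {ν : Euc (n + 1)} (hν : ‖ν‖ = 1)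
    {D : Set (Euc (n + 1))} (hb : Bornology.IsBounded D)
    (hD : ∀ x ∈ D, ∀ y ∈ D, ⟪ν, y - x⟫ ≤ 1 / 2 * ‖y - x‖) : μH[(n : ℝ)] D < ⊤ := by
  obtain ⟨R, hR⟩ := exists_isometry_apply_zero_eq_inner hν
  have hanti : ∀ x ∈ D, ∀ y ∈ D,
      dist x y ≤ (2 * n : ℝ≥0) * dist (splitFirst (R x)).2 (splitFirst (R y)).2 := by
    intro x hx y hy
    rw [← R.dist_map]
    refine dist_le_of_splitFirst _ _ ?_
    rw [← map_sub, hR, R.norm_map, abs_le]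
    have h1 := hD x hx y hy
    have h2 := hD y hy x hx
    rw [norm_sub_rev, ← neg_sub x y, inner_neg_right] at h1
    exact ⟨by linarith, h2⟩
  refine (hausdorffMeasure_le_mul_image hanti n.cast_nonneg).trans_lt ?_
  refine ENNReal.mul_lt_top (ENNReal.rpow_lt_top_of_nonneg n.cast_nonneg ENNReal.coe_ne_top) ?_
  have hlip : LipschitzWith 1 (fun y => (splitFirst (R y)).2) :=
    LipschitzWith.of_dist_le_mul fun x y => by
      simpa using dist_splitFirst_snd_le (R x) (R y)
  have hbd := hlip.isBounded_image hb
  have h1 := hbd.measure_lt_top (μ := volume)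
  rwa [← hausdorffMeasure_pi_real, Fintype.card_fin] at h1

theorem InteriorBall.hausdorffMeasure_frontier_lt_top {n : ℕ} {E : Set (Euc (n + 1))}
    (hb : Bornology.IsBounded E) {r : ℝ} (hr : 0 < r) (hball : InteriorBall r E) :
    μH[(n : ℝ)] (frontier E) < ⊤ := by
  have hdir : ∀ x ∈ frontier E, ∃ ν : Euc (n + 1), ‖ν‖ = 1 ∧
      ∀ y ∈ frontier E, ⟪ν, y - x⟫ ≤ ‖y - x‖ ^ 2 / (2 * r) := by
    intro x hx
    obtain ⟨z, hxz, hzE⟩ := hball x hx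
    rw [dist_eq_norm, norm_sub_rev] at hxz
    refine ⟨r⁻¹ • (z - x), ?_, fun y hy => ?_⟩
    · rw [norm_smul, hxz, Real.norm_of_nonneg (by positivity), inv_mul_cancel₀ hr.ne']
    · have h1 : r ≤ ‖(y - x) - (z - x)‖ := by
        rw [sub_sub_sub_cancel_right, ← dist_eq_norm]
        by_contra! hlt
        have : ball z r ⊆ interior E :=
          interior_maximal (ball_subset_closedBall.trans hzE) isOpen_ball
        exact hy.2 (this hlt)
      have h2 : r ^ 2 ≤ ‖(y - x) - (z - x)‖ ^ 2 := by gcongr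
      rw [norm_sub_sq_real, hxz, real_inner_comm] at h2
      rw [inner_smul_left, conj_trivial, inv_mul_le_iff₀ hr]
      have : r * (‖y - x‖ ^ 2 / (2 * r)) = ‖y - x‖ ^ 2 / 2 := by field_simp
      rw [this]
      linarith
  choose! ν hν1 hν using hdir
  have hF : TotallyBounded (frontier E) :=
    (Metric.isCompact_of_isClosed_isBounded isClosed_frontier
      (hb.closure.subset frontier_subset_closure)).totallyBounded
  have hSph : TotallyBounded (sphere (0 : Euc (n + 1)) 1) := (isCompact_sphere 0 1).totallyBounded
  obtain ⟨s, -, hs, hsc⟩ := Metric.finite_approx_of_totallyBounded hF (r / 4) (by positivity)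
  obtain ⟨t, hts, ht, htc⟩ := Metric.finite_approx_of_totallyBounded hSph (1 / 4) (by norm_num)
  have hcov : frontier E ⊆ ⋃ c ∈ s, ⋃ w ∈ t,
      {x | x ∈ frontier E ∧ x ∈ ball c (r / 4) ∧ ν x ∈ ball w (1 / 4)} := by
    intro x hx
    obtain ⟨c, hc, hxc⟩ := mem_iUnion₂.1 (hsc hx)
    obtain ⟨w, hw, hxw⟩ := mem_iUnion₂.1 (htc (show ν x ∈ sphere 0 1 by simpa using hν1 x hx))
    exact mem_iUnion₂.2 ⟨c, hc, mem_iUnion₂.2 ⟨w, hw, hx, hxc, hxw⟩⟩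
  refine (measure_mono hcov).trans_lt ?_
  refine measure_biUnion_lt_top hs fun c hc => measure_biUnion_lt_top ht fun w hw => ?_
  refine hausdorffMeasure_ne_top_of_almost_flat (ν := w) (by simpa using hts hw)
    (isBounded_ball.subset fun x hx => hx.2.1) ?_
  rintro x ⟨hx, hxc, hxw⟩ y ⟨hy, hyc, -⟩
  have h1 := hν x hx y hy
  have h2 : ⟪w - ν x, y - x⟫ ≤ 1 / 4 * ‖y - x‖ := by
    refine (real_inner_le_norm _ _).trans ?_
    gcongr
    rw [← dist_eq_norm, dist_comm]; exact (mem_ball.1 hxw).le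
  have h3 : ‖y - x‖ ≤ r / 2 := by
    rw [← dist_eq_norm]
    have := dist_triangle_right y x c
    rw [mem_ball] at hxc hyc
    linarith
  have h4 : ‖y - x‖ ^ 2 / (2 * r) ≤ 1 / 4 * ‖y - x‖ := by
    rw [div_le_iff₀ (by positivity)]
    nlinarith [norm_nonneg (y - x)]
  rw [inner_sub_left] at h2
  linarith

theorem mem_superDiff_of_touching {N : ℕ} {v G : Euc N → ℝ} {x p : Euc N}
    (hG : HasGradientAt G p x) (h : ∀ᶠ y in 𝓝 x, v y - v x ≤ G y - G x) : p ∈ SuperDiff v x := by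
  intro ε hε
  have h1 := (hasFDerivAt_iff_isLittleO.1 hG.hasFDerivAt).bound hε
  filter_upwards [nhdsWithin_le_nhds h, nhdsWithin_le_nhds h1, self_mem_nhdsWithin] with y hy hy1 hne
  have hpos : 0 < ‖y - x‖ := norm_pos_iff.2 (sub_ne_zero.2 hne)
  rw [div_le_iff₀ hpos]
  have h2 := (le_abs_self _).trans hy1
  rw [InnerProductSpace.toDual_apply_apply] at h2
  linarith

theorem Semiconvex.le_of_differentiableAt {N : ℕ} {C : ℝ} {v : Euc N → ℝ} (hv : Semiconvex C v)
    {x : Euc N} (hd : DifferentiableAt ℝ v x) (y : Euc N) :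
    v x + ⟪gradient v x, y - x⟫ - C / 2 * ‖y - x‖ ^ 2 ≤ v y := by
  set w := y - x with hw
  set φ : ℝ → ℝ := fun t => v (x + t • w) + C / 2 * t ^ 2 * ‖w‖ ^ 2 with hφ
  have hmid : ∀ t, 2 * (φ (t / 2) - φ 0) ≤ φ t - φ 0 := by
    intro t
    have h1 := hv (x + (t / 2) • w) ((t / 2) • w)
    rw [add_assoc, ← add_smul, add_halves, add_sub_cancel_right, norm_smul, mul_pow,
      Real.norm_eq_abs, sq_abs] at h1
    simp only [hφ, zero_smul, add_zero]
    nlinarith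
  have hpow : ∀ k : ℕ, 2 ^ k * (φ ((1 / 2) ^ k) - φ 0) ≤ φ 1 - φ 0 := by
    intro k
    induction k with
    | zero => simp
    | succ k ih =>
      have h1 := hmid ((1 / 2) ^ k)
      rw [show (1 / 2 : ℝ) ^ k / 2 = (1 / 2) ^ (k + 1) by ring] at h1
      refine le_trans ?_ ih
      rw [pow_succ, mul_assoc]
      gcongr
  have hder : HasDerivAt φ ⟪gradient v x, w⟫ 0 := by
    have h1 : HasFDerivAt v (fderiv ℝ v x) (x + (0 : ℝ) • w) := by simpa using hd.hasFDerivAt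
    have h2 : HasDerivAt (fun t : ℝ => x + t • w) w 0 := by
      simpa using ((hasDerivAt_id (0 : ℝ)).smul_const w).const_add x
    have h3 := h1.comp_hasDerivAt (0 : ℝ) h2
    have h4 : HasDerivAt (fun t : ℝ => C / 2 * t ^ 2 * ‖w‖ ^ 2) 0 0 := by
      simpa using (((hasDerivAt_id (0 : ℝ)).pow 2).const_mul (C / 2)).mul_const (‖w‖ ^ 2)
    have h5 := h3.add h4
    rw [add_zero] at h5
    rw [gradient, InnerProductSpace.toDual_symm_apply]
    exact h5
  have hlim : Tendsto (fun k : ℕ => (2 : ℝ) ^ k * (φ ((1 / 2) ^ k) - φ 0)) atTop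
      (𝓝 ⟪gradient v x, w⟫) := by
    have h1 := hasDerivAt_iff_tendsto_slope_zero.1 hder
    have h2 : Tendsto (fun k : ℕ => (1 / 2 : ℝ) ^ k) atTop (𝓝[≠] 0) :=
      tendsto_nhdsWithin_iff.2 ⟨tendsto_pow_atTop_nhds_zero_of_lt_one (by norm_num) (by norm_num),
        Eventually.of_forall fun k => by simp⟩
    refine (h1.comp h2).congr fun k => ?_
    simp
  have hfin := le_of_tendsto' hlim hpow
  simp only [hφ, one_smul, zero_smul, add_zero] at hfin
  rw [show x + w = y by rw [hw]; abel] at hfin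
  linarith

theorem exists_large_subgradient {N : ℕ} {u0 : Euc N → ℝ} {K : ℝ≥0} (hu0 : LipschitzWith K u0)
    {C0 : ℝ} (hsc : Semiconvex C0 u0) {η0 : ℝ}
    (hH3 : ∀ x : Euc N, ∀ p ∈ SuperDiff u0 x, η0 ≤ |u0 x| + ‖p‖) (x : Euc N) :
    ∃ p : Euc N, η0 ≤ |u0 x| + ‖p‖ ∧
      ∀ y, u0 x + ⟪p, y - x⟫ - C0 / 2 * ‖y - x‖ ^ 2 ≤ u0 y := by
  have hdense : Dense {z | DifferentiableAt ℝ u0 z} :=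
    Measure.dense_of_ae (μ := (volume : Measure (Euc N))) hu0.ae_differentiableAt
  obtain ⟨z, hz, hzx⟩ := mem_closure_iff_seq_limit.1 (hdense x)
  have hb : ∀ k, gradient u0 (z k) ∈ closedBall (0 : Euc N) K := fun k => by
    rw [mem_closedBall_zero_iff, gradient, LinearIsometryEquiv.norm_map]
    exact norm_fderiv_le_of_lipschitz ℝ hu0
  obtain ⟨p, -, σ, hσ, hp⟩ := (isCompact_closedBall (0 : Euc N) K).tendsto_subseq hb
  have hzσ : Tendsto (z ∘ σ) atTop (𝓝 x) := hzx.comp hσ.tendsto_atTop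
  have huσ : Tendsto (fun k => u0 (z (σ k))) atTop (𝓝 (u0 x)) := (hu0.continuous.tendsto x).comp hzσ
  refine ⟨p, ?_, fun y => ?_⟩
  · refine ge_of_tendsto' (huσ.abs.add hp.norm) fun k => ?_
    refine hH3 _ _ (mem_superDiff_of_touching (G := u0) ?_ (Eventually.of_forall fun _ => le_rfl))
    exact (hz (σ k)).hasGradientAt
  · have hyσ : Tendsto (fun k => y - z (σ k)) atTop (𝓝 (y - x)) := hzσ.const_sub y
    refine le_of_tendsto' ((huσ.add (hp.inner hyσ)).sub ((hyσ.norm.pow 2).const_mul (C0 / 2)))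
      fun k => hsc.le_of_differentiableAt (hz (σ k)) y

theorem interiorBall_superlevel {N : ℕ} {u0 : Euc N → ℝ} {K : ℝ≥0} (hu0 : LipschitzWith K u0)
    {C0 : ℝ} (hC0 : 0 < C0) (hsc : Semiconvex C0 u0) {η0 : ℝ} (hη0 : 0 < η0)
    (hH3 : ∀ x : Euc N, ∀ p ∈ SuperDiff u0 x, η0 ≤ |u0 x| + ‖p‖) {b : ℝ} (hb : |b| < η0 / 2) :
    InteriorBall (η0 / (2 * C0)) {x | b ≤ u0 x} := by
  intro x hx
  have hxb : b = u0 x := frontier_le_subset_eq continuous_const hu0.continuous hx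
  obtain ⟨p, hp, hsub⟩ := exists_large_subgradient hu0 hsc hH3 x
  rw [← hxb] at hp
  have hp2 : η0 / 2 ≤ ‖p‖ := by linarith
  have hp0 : 0 < ‖p‖ := by linarith
  set r := η0 / (2 * C0) with hr
  have hr0 : 0 < r := by positivity
  have hrC : r * C0 = η0 / 2 := by rw [hr]; field_simp
  have hnr : ‖(r / ‖p‖) • p‖ = r := by
    rw [norm_smul, Real.norm_of_nonneg (by positivity), div_mul_cancel₀ _ hp0.ne']
  refine ⟨x + (r / ‖p‖) • p, by rw [dist_self_add_right, hnr], fun y hy => ?_⟩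
  rw [mem_closedBall, dist_eq_norm, ← sub_sub] at hy
  have h1 : ‖y - x - (r / ‖p‖) • p‖ ^ 2 ≤ r ^ 2 := by gcongr
  rw [norm_sub_sq_real, hnr, inner_smul_right, real_inner_comm] at h1
  have h2 : ‖y - x‖ ^ 2 ≤ 2 * (r / ‖p‖ * ⟪p, y - x⟫) := by linarith
  have h3 : ‖p‖ * ‖y - x‖ ^ 2 ≤ 2 * r * ⟪p, y - x⟫ := by
    calc ‖p‖ * ‖y - x‖ ^ 2 ≤ ‖p‖ * (2 * (r / ‖p‖ * ⟪p, y - x⟫)) := by gcongr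
      _ = _ := by field_simp
  have h4 : η0 / 2 * ‖y - x‖ ^ 2 ≤ ‖p‖ * ‖y - x‖ ^ 2 := by gcongr
  have h5 : r * (C0 / 2 * ‖y - x‖ ^ 2) ≤ r * ⟪p, y - x⟫ := by
    have : r * (C0 / 2 * ‖y - x‖ ^ 2) = (η0 / 2 * ‖y - x‖ ^ 2) / 2 := by rw [← hrC]; ring
    rw [this]; linarith
  have h6 := le_of_mul_le_mul_left h5 hr0
  have h7 := hsub y
  change b ≤ u0 y
  linarith

theorem exists_ascent {N : ℕ} {u0 : Euc N → ℝ} (hu0 : Continuous u0) {η0 : ℝ} (hη0 : 0 < η0)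
    (hH3 : ∀ x : Euc N, ∀ p ∈ SuperDiff u0 x, η0 ≤ |u0 x| + ‖p‖) {a b : ℝ} (ha : -(η0 / 2) < a)
    (hab : a < b) (hb : b < η0 / 2) {x : Euc N} (hx : a ≤ u0 x) :
    ∃ y, b ≤ u0 y ∧ dist x y ≤ 2 * (b - a) / η0 := by
  set h := 2 * (b - a) / η0 with hh
  have hh0 : 0 < h := by rw [hh]; have := sub_pos.2 hab; positivity
  have hηh : η0 / 2 * h = b - a := by rw [hh]; field_simp
  by_contra! hcon
  have hlt : ∀ y ∈ closedBall x h, u0 y < b := by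
    intro y hy
    by_contra! hby
    exact absurd (hcon y hby) (not_lt.2 (by rw [dist_comm]; exact hy))
  have hcomp := isCompact_closedBall x h
  have hxb : x ∈ closedBall x h := mem_closedBall_self hh0.le
  obtain ⟨ym, hym, hmax⟩ := hcomp.exists_isMaxOn ⟨x, hxb⟩ hu0.continuousOn
  set ε := (b - u0 ym) / η0 with hε
  have hε0 : 0 < ε := by rw [hε]; have := sub_pos.2 (hlt ym hym); positivity
  have hεm : η0 * ε = b - u0 ym := by rw [hε]; field_simp
  set G : Euc N → ℝ := fun y => η0 / 2 * √(‖y - x‖ ^ 2 + ε ^ 2) with hG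
  have hGc : Continuous G := by fun_prop
  obtain ⟨y, hy, hymax⟩ := hcomp.exists_isMaxOn ⟨x, hxb⟩ (hu0.sub hGc).continuousOn
  have hyx : u0 x - G x ≤ u0 y - G y := hymax hxb
  have hGx : G x = η0 / 2 * ε := by simp [hG, Real.sqrt_sq hε0.le]
  have hGy : η0 / 2 * ‖y - x‖ ≤ G y := by
    simp only [hG]
    gcongr
    exact Real.le_sqrt_of_sq_le (by nlinarith)
  have hGy' : η0 / 2 * ε ≤ G y := by
    simp only [hG]
    gcongr
    exact Real.le_sqrt_of_sq_le (by nlinarith [sq_nonneg ‖y - x‖])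
  have hymax' : u0 y ≤ u0 ym := hmax hy
  have hya : a ≤ u0 y := by linarith
  have hyint : y ∈ ball x h := by
    rw [mem_ball, dist_eq_norm]
    by_contra! hge
    have h1 : η0 / 2 * h ≤ η0 / 2 * ‖y - x‖ := by gcongr
    nlinarith [hlt ym hym]
  set q := √(‖y - x‖ ^ 2 + ε ^ 2) with hq
  have hq0 : 0 < q := Real.sqrt_pos.2 (by positivity)
  have hgrad : HasGradientAt G ((η0 / 2 / q) • (y - x)) y := by
    rw [hasGradientAt_iff_hasFDerivAt]
    have h1 : HasFDerivAt (fun z : Euc N => z - x) (ContinuousLinearMap.id ℝ (Euc N)) y :=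
      (hasFDerivAt_id y).sub_const x
    have h2 := ((h1.norm_sq.add_const (ε ^ 2)).sqrt (by positivity)).const_mul (η0 / 2)
    refine h2.congr_fderiv (ContinuousLinearMap.ext fun z => ?_)
    simp [← hq]
    field_simp
  have hsd : (η0 / 2 / q) • (y - x) ∈ SuperDiff u0 y := by
    refine mem_superDiff_of_touching hgrad ?_
    filter_upwards [isOpen_ball.mem_nhds hyint] with z hz
    have : u0 z - G z ≤ u0 y - G y := hymax (ball_subset_closedBall hz)
    linarith
  have h3 := hH3 y _ hsd
  have h4 : ‖(η0 / 2 / q) • (y - x)‖ ≤ η0 / 2 := by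
    rw [norm_smul, Real.norm_of_nonneg (by positivity), div_mul_eq_mul_div, div_le_iff₀ hq0]
    gcongr
  have h5 : |u0 y| < η0 / 2 := abs_lt.2 ⟨by linarith, by linarith [hlt y hy]⟩
  linarith

theorem volume_level_eq_zero {n : ℕ} {u0 : Euc (n + 1) → ℝ} {K : ℝ≥0} (hu0 : LipschitzWith K u0)
    {η0 : ℝ} (hH3 : ∀ x, ∀ p ∈ SuperDiff u0 x, η0 ≤ |u0 x| + ‖p‖) {b : ℝ} (hb : |b| < η0) :
    volume {x | u0 x = b} = 0 := by
  set e : Euc (n + 1) := EuclideanSpace.single 0 1 with he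
  have hen : ‖e‖ = 1 := by simp [he]
  set S := {x | u0 x = b} ∩ {x | DifferentiableAt ℝ u0 x} with hS
  have hSm : MeasurableSet S :=
    (hu0.continuous.measurable (measurableSet_singleton b)).inter
      (measurableSet_of_differentiableAt ℝ u0)
  have happ : ApproximatesLinearOn (fun y => u0 y • e) (0 : Euc (n + 1) →L[ℝ] Euc (n + 1)) S 0 := by
    intro x hx y hy
    have h1 : u0 x = b := hx.1
    have h2 : u0 y = b := hy.1
    simp [h1, h2]
  have hae := happ.norm_fderiv_sub_le volume hSm (fun y => (fderiv ℝ u0 y).smulRight e)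
    (fun x hx => (hx.2.hasFDerivAt.smul_const e).hasFDerivWithinAt)
  have hno : ∀ᵐ x : Euc (n + 1), x ∉ {x | u0 x = b} := by
    filter_upwards [(ae_restrict_iff' hSm).1 hae, hu0.ae_differentiableAt] with x hx hd hxb
    have h1 := hx ⟨hxb, hd⟩
    rw [sub_zero, nonpos_iff_eq_zero, nnnorm_eq_zero] at h1
    have h2 : fderiv ℝ u0 x = 0 := by
      ext z
      have h3 := congrArg norm (DFunLike.congr_fun h1 z)
      simpa [norm_smul, hen] using h3
    have h3 := hH3 x _ (mem_superDiff_of_touching hd.hasGradientAt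
      (Eventually.of_forall fun _ => le_rfl))
    have hxb' : u0 x = b := hxb
    rw [gradient, h2, map_zero, norm_zero, add_zero, hxb'] at h3
    linarith
  exact measure_eq_zero_iff_ae_notMem.2 hno

theorem isBounded_superlevel {N : ℕ} {u0 : Euc N → ℝ} (hu0 : Continuous u0) {η0 : ℝ} (hη0 : 0 < η0)
    (hH3 : ∀ x : Euc N, ∀ p ∈ SuperDiff u0 x, η0 ≤ |u0 x| + ‖p‖)
    (hcpt : IsCompact {x : Euc N | 0 ≤ u0 x}) {b : ℝ} (hb : -(η0 / 2) < b) :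
    Bornology.IsBounded {x : Euc N | b ≤ u0 x} := by
  rcases le_or_gt 0 b with h0 | h0
  · exact hcpt.isBounded.subset fun x hx => h0.trans hx
  · refine (hcpt.isBounded.cthickening (δ := 2 * (0 - b) / η0)).subset fun x hx => ?_
    obtain ⟨y, hy, hxy⟩ := exists_ascent hu0 hη0 hH3 hb h0 (by positivity) hx
    exact mem_cthickening_of_dist_le x y _ _ hy hxy

/-- Measure of a band between two level sets of the initial datum, controlled by the perimeter of
its inner boundary. -/
theorem volume_band_le {n : ℕ} {u0 : Euc (n + 1) → ℝ} {K : ℝ≥0} (hu0 : LipschitzWith K u0)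
    {C0 : ℝ} (hC0 : 0 < C0) (hsc : Semiconvex C0 u0) {η0 : ℝ} (hη0 : 0 < η0)
    (hH3 : ∀ x, ∀ p ∈ SuperDiff u0 x, η0 ≤ |u0 x| + ‖p‖) {a b : ℝ} (ha : -(η0 / 2) < a)
    (hab : a < b) (hb : b < η0 / 2) (hba : b - a ≤ η0 ^ 2 / (2 * C0)) :
    volume {x | a ≤ u0 x ∧ u0 x ≤ b} ≤
      ENNReal.ofReal (3 ^ (n + 1) * (b - a) / η0) * μH[(n : ℝ)] (frontier {x | b ≤ u0 x}) := by
  set E := {x | b ≤ u0 x} with hE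
  set h := 2 * (b - a) / η0 with hh
  have hEc : IsClosed E := isClosed_le continuous_const hu0.continuous
  have hasc : ∀ x, a ≤ u0 x → ∃ y ∈ E, dist x y ≤ h := fun x hx =>
    exists_ascent hu0.continuous hη0 hH3 ha hab hb hx
  rcases E.eq_empty_or_nonempty with hemp | hne
  · have : {x | a ≤ u0 x ∧ u0 x ≤ b} = ∅ := by
      refine eq_empty_iff_forall_notMem.2 fun x hx => ?_
      obtain ⟨y, hy, -⟩ := hasc x hx.1
      rw [hemp] at hy
      exact hy
    simp [this]
  have hbabs : |b| < η0 / 2 := abs_lt.2 ⟨by linarith, hb⟩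
  have hsub : {x | a ≤ u0 x ∧ u0 x ≤ b} ⊆ {y | infDist y E ∈ Ioc 0 h} ∪ {x | u0 x = b} := by
    rintro x ⟨hxa, hxb⟩
    rcases hxb.lt_or_eq with hlt | heq
    · left
      obtain ⟨y, hy, hxy⟩ := hasc x hxa
      refine ⟨(hEc.notMem_iff_infDist_pos hne).1 fun hxE => ?_, (infDist_le_dist_of_mem hy).trans hxy⟩
      exact absurd hlt (not_lt.2 hxE)
    · exact Or.inr heq
  have hhr : h ≤ 2 * (η0 / (2 * C0)) := by
    rw [hh, div_le_iff₀ hη0]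
    calc 2 * (b - a) ≤ 2 * (η0 ^ 2 / (2 * C0)) := by gcongr
      _ = 2 * (η0 / (2 * C0)) * η0 := by ring
  have hshell := volume_infDist_shell_le hEc hne (by positivity) hhr
    (interiorBall_superlevel hu0 hC0 hsc hη0 hH3 hbabs)
  calc _ ≤ volume {y | infDist y E ∈ Ioc 0 h} + volume {x | u0 x = b} :=
        (measure_mono hsub).trans (measure_union_le _ _)
    _ ≤ ENNReal.ofReal (3 ^ (n + 1) * h / 2) * μH[(n : ℝ)] (frontier E) := by
        rw [volume_level_eq_zero hu0 hH3 (by linarith), add_zero]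
        exact hshell
    _ = _ := by
        congr 2
        rw [hh]; ring

/-- refined estimate of the measure of small level-sets in terms of the
perimeter of a level-set of the initial datum. -/
theorem stmt17 (N : ℕ) (hN : 1 ≤ N) (T : ℝ) (hT : 0 < T)
    (c : Euc N → ℝ → ℝ)
    (hc : ContinuousOn (fun p : Euc N × ℝ => c p.1 p.2)
      ((Set.univ : Set (Euc N)) ×ˢ Set.Icc (0 : ℝ) T))
    (L1 L1' L2 : ℝ) (hL1 : 0 < L1) (hL1' : 0 < L1') (hL2 : 0 < L2)
    (hH1 : ∀ x y : Euc N, ∀ t ∈ Set.Icc (0 : ℝ) T,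
      |c x t - c y t| ≤ L1 * ‖x - y‖ ∧ |c x t| ≤ L1')
    (hH2 : ∀ x : Euc N, ∀ t ∈ Set.Icc (0 : ℝ) T, 0 ≤ c x t)
    (hH4 : ∀ t ∈ Set.Icc (0 : ℝ) T, Semiconvex L2 (fun x => c x t))
    (u0 : Euc N → ℝ) (K : ℝ≥0) (hu0 : LipschitzWith K u0)
    (C0 : ℝ) (hC0 : 0 < C0) (hu0sc : Semiconvex C0 u0)
    (η0 : ℝ) (hη0 : 0 < η0)
    (hH3 : ∀ x : Euc N, ∀ p ∈ SuperDiff u0 x, η0 ≤ |u0 x| + ‖p‖)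
    (hcpt : IsCompact {x : Euc N | 0 ≤ u0 x})
    (u : Euc N → ℝ → ℝ)
    (hulip : ∃ K' : ℝ≥0, LipschitzOnWith K' (fun p : Euc N × ℝ => u p.1 p.2)
      ((Set.univ : Set (Euc N)) ×ˢ Set.Icc (0 : ℝ) T))
    (husol : IsViscositySolution N T c u u0)
    (γ η : ℝ) (hγ : 0 < γ) (hη : 0 < η)
    (hlb : ∀ᵐ p : Euc N × ℝ ∂volume, p.2 ∈ Set.Ioo 0 T →
      -|u p.1 p.2| - Real.exp (γ * p.2) / 4 * ‖gradient (fun y => u y p.2) p.1‖ ^ 2 + η ≤ 0)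
    (L4 : ℝ) (hL4 : 0 < L4)
    (hL4est : ∀ a b : ℝ, -η / 2 < a → a < b → b < η / 2 → ∀ t ∈ Set.Icc (0 : ℝ) T,
      volume {x : Euc N | a ≤ u x t ∧ u x t ≤ b} ≤
        ENNReal.ofReal (Real.exp (L4 * t)) * volume {x : Euc N | a ≤ u0 x ∧ u0 x ≤ b}) :
    ∀ a b : ℝ,
      -min (η / 2) (min (η0 / 2) (η0 ^ 2 / (4 * C0))) < a → a < b →
      b < min (η / 2) (min (η0 / 2) (η0 ^ 2 / (4 * C0))) →
      μH[(N : ℝ) - 1] (frontier {x : Euc N | b ≤ u0 x}) ≠ ⊤ ∧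
      ∀ t ∈ Set.Icc (0 : ℝ) T,
        volume {x : Euc N | a ≤ u x t ∧ u x t ≤ b} ≤
          ENNReal.ofReal ((3 : ℝ) ^ N * Real.exp (L4 * t) * (b - a) / η0) *
            μH[(N : ℝ) - 1] (frontier {x : Euc N | b ≤ u0 x}) := by
  intro a b ha hab hb
  obtain ⟨n, rfl⟩ : ∃ n, N = n + 1 := ⟨N - 1, by omega⟩
  have hn : ((n + 1 : ℕ) : ℝ) - 1 = n := by push_cast; ring
  rw [hn]
  set m := min (η / 2) (min (η0 / 2) (η0 ^ 2 / (4 * C0))) with hm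
  have hm1 : m ≤ η / 2 := min_le_left _ _
  have hm2 : m ≤ η0 / 2 := (min_le_right _ _).trans (min_le_left _ _)
  have hm3 : m ≤ η0 ^ 2 / (4 * C0) := (min_le_right _ _).trans (min_le_right _ _)
  have hba : b - a ≤ η0 ^ 2 / (2 * C0) := by
    have : η0 ^ 2 / (2 * C0) = 2 * (η0 ^ 2 / (4 * C0)) := by ring
    linarith
  refine ⟨?_, fun t ht => ?_⟩
  · have hbd := isBounded_superlevel hu0.continuous hη0 hH3 hcpt (b := b) (by linarith)
    exact ((interiorBall_superlevel hu0 hC0 hu0sc hη0 hH3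
      (abs_lt.2 ⟨by linarith, by linarith⟩)).hausdorffMeasure_frontier_lt_top hbd
        (by positivity)).ne
  · refine (hL4est a b (by linarith) hab (by linarith) t ht).trans ?_
    have hband := volume_band_le hu0 hC0 hu0sc hη0 hH3 (a := a) (b := b) (by linarith) hab
      (by linarith) hba
    refine (mul_le_mul_right hband _).trans_eq ?_
    rw [← mul_assoc, ← ENNReal.ofReal_mul (Real.exp_nonneg _)]
    congr 2
    ring
end
end
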